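/- arXiv:2004.06462 — 4 statements merged into one kernel-verified Lean document; each statement's English description precedes it below -/
import Mathlib

section
/- Adjoint identity for S_y^α on monomials (Lemma adjointS): let α > -1, β, η > 0, x > 0, y > 0, fix I ∈ ℍ with I² = -1, and let n ∈ ℕ. Then ∫∫_{{u²+v²<1}} R_{conj(u+vI)}^α(x,y) · (u+vI)ⁿ · ω_{β,η}(u²+v²) du dv = π γ_n^{β,η} φ_n^α(y) φ_n^α(x); that is, the adjoint (S_y^α)* sends the monomial e_n(q) = qⁿ to π γ_n^{β,η} φ_n^α(y) φ_n^α. -/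
open MeasureTheory Real Quaternion

/-- Generalized Laguerre polynomial `L_n^{(α)}(x)`. -/
noncomputable def genLaguerre (α : ℝ) (n : ℕ) (x : ℝ) : ℝ :=
  ∑ k ∈ Finset.range (n + 1),
    ((-1 : ℝ) ^ k / (Nat.factorial k)) *
      (Real.Gamma (n + α + 1) / (Real.Gamma (k + α + 1) * (Nat.factorial (n - k)))) * x ^ k

/-- Normalized Laguerre function `φ_n^α(x)`. -/
noncomputable def lagPhi (α : ℝ) (n : ℕ) (x : ℝ) : ℝ :=
  Real.sqrt ((Nat.factorial n : ℝ) / Real.Gamma (n + α + 1)) * genLaguerre α n x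

/-- `γ_n^{β,η} = Γ(η)Γ(β+n)/Γ(β+η+n)`. -/
noncomputable def gamCoef (β η : ℝ) (n : ℕ) : ℝ :=
  Real.Gamma η * Real.Gamma (β + n) / Real.Gamma (β + η + n)

/-- Weight `ω_{β,η}(t) = t^{β-1}(1-t)^{η-1}`. -/
noncomputable def weightBeta (β η t : ℝ) : ℝ := t ^ (β - 1) * (1 - t) ^ (η - 1)

/-- The kernel `R_q^α(x,y) = Σ_n qⁿ φ_n^α(x) φ_n^α(y)`. -/
noncomputable def Rker (α : ℝ) (q : ℍ[ℝ]) (x y : ℝ) : ℍ[ℝ] :=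
  ∑' n : ℕ, (lagPhi α n x * lagPhi α n y) • q ^ n

open Polynomial in
/-- Laguerre polynomial as a polynomial. -/
noncomputable def lagPoly (α : ℝ) (n : ℕ) : Polynomial ℝ :=
  ∑ k ∈ Finset.range (n + 1),
    C (((-1 : ℝ) ^ k / (Nat.factorial k)) *
      (Real.Gamma (n + α + 1) / (Real.Gamma (k + α + 1) * (Nat.factorial (n - k))))) * X ^ k

lemma lagPoly_eval (α : ℝ) (n : ℕ) (x : ℝ) : (lagPoly α n).eval x = genLaguerre α n x := by
  simp only [lagPoly, genLaguerre, Polynomial.eval_finsetSum, Polynomial.eval_mul,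
    Polynomial.eval_C, Polynomial.eval_pow, Polynomial.eval_X]

lemma lagPoly_coeff (α : ℝ) (n k : ℕ) : (lagPoly α n).coeff k = if k < n + 1 then
    (((-1 : ℝ) ^ k / (Nat.factorial k)) *
      (Real.Gamma (n + α + 1) / (Real.Gamma (k + α + 1) * (Nat.factorial (n - k))))) else 0 := by
  simp only [lagPoly, Polynomial.finsetSum_coeff, Polynomial.coeff_C_mul, Polynomial.coeff_X_pow,
    mul_ite, mul_one, mul_zero, Finset.sum_ite_eq, Finset.mem_range]

lemma lagPoly_coeff_rec (α : ℝ) (hα : -1 < α) (n k : ℕ) :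
    (lagPoly α n).coeff (k + 1) * ((k + 1) * (k + 1 + α)) = ((k : ℝ) - n) * (lagPoly α n).coeff k := by
  rw [lagPoly_coeff, lagPoly_coeff]
  rcases lt_trichotomy k n with h | h | h
  · rw [if_pos (by omega), if_pos (by omega)]
    obtain ⟨m, rfl⟩ : ∃ m, n = k + 1 + m := ⟨n - (k + 1), by omega⟩
    have e1 : k + 1 + m - (k + 1) = m := by omega
    have e2 : k + 1 + m - k = m + 1 := by omega
    have hp : 0 < (k : ℝ) + α + 1 := by
      have : (0 : ℝ) ≤ k := Nat.cast_nonneg k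
      linarith
    have hG : Real.Gamma (((k + 1 : ℕ) : ℝ) + α + 1) = (k + α + 1) * Real.Gamma (k + α + 1) := by
      rw [← Real.Gamma_add_one hp.ne']; congr 1; push_cast; ring
    have hG0 := (Real.Gamma_pos_of_pos hp).ne'
    rw [e1, e2, hG, Nat.factorial_succ, Nat.factorial_succ]
    have f1 : (Nat.factorial k : ℝ) ≠ 0 := by positivity
    have f2 : (Nat.factorial m : ℝ) ≠ 0 := by positivity
    have hp' := hp.ne'
    push_cast
    have : (k : ℝ) + 1 ≠ 0 := by positivity
    have : (m : ℝ) + 1 ≠ 0 := by positivity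
    field_simp
    ring
  · subst h
    simp
  · rw [if_neg (by omega), if_neg (by omega)]; simp

open Polynomial in
lemma lagPoly_ode (α : ℝ) (hα : -1 < α) (n : ℕ) :
    X * derivative (derivative (lagPoly α n)) + C (α + 1) * derivative (lagPoly α n)
      - X * derivative (lagPoly α n) + C (n : ℝ) * lagPoly α n = 0 := by
  ext k
  have h := lagPoly_coeff_rec α hα n k
  rcases k with _ | k
  · simp [coeff_derivative] at h ⊢
    linarith
  · simp only [coeff_add, coeff_sub, coeff_X_mul, coeff_C_mul, coeff_derivative, coeff_zero]
    push_cast at h ⊢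
    linarith

lemma gamma_lower (α : ℝ) (hα : -1 < α) :
    ∃ δ > 0, ∀ k : ℕ, δ ≤ Real.Gamma (k + α + 1) := by
  refine ⟨min (Real.Gamma (α + 1)) (Real.Gamma (α + 2)),
    lt_min (Real.Gamma_pos_of_pos (by linarith)) (Real.Gamma_pos_of_pos (by linarith)), ?_⟩
  intro k
  rcases k with _ | k
  · simp
  · refine (min_le_right _ _).trans ?_
    induction k with
    | zero => apply le_of_eq; congr 1; push_cast; ring
    | succ k ih =>
      refine ih.trans ?_
      have : (0 : ℝ) ≤ k := Nat.cast_nonneg k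
      have h1 : Real.Gamma (((k + 1 + 1 : ℕ) : ℝ) + α + 1)
          = (((k + 1 : ℕ) : ℝ) + α + 1) * Real.Gamma (((k + 1 : ℕ) : ℝ) + α + 1) := by
        rw [← Real.Gamma_add_one (by push_cast; linarith)]; congr 1; push_cast; ring
      rw [h1]
      have h2 : 0 < Real.Gamma (((k + 1 : ℕ) : ℝ) + α + 1) :=
        Real.Gamma_pos_of_pos (by push_cast; linarith)
      have : 1 ≤ (((k + 1 : ℕ) : ℝ) + α + 1) := by push_cast; linarith
      nlinarith

/-- value and derivative bounds at `1/n`. -/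
lemma lagPoly_bounds (α : ℝ) (hα : -1 < α) : ∃ A > 0, ∀ n : ℕ, 1 ≤ n →
    |(lagPoly α n).eval (1 / (n : ℝ))| ≤ A * (Real.Gamma (n + α + 1) / Nat.factorial n) ∧
    |(Polynomial.derivative (lagPoly α n)).eval (1 / (n : ℝ))| ≤
      A * (Real.Gamma (n + α + 1) / Nat.factorial n) * n := by
  obtain ⟨δ, hδ, hΓ⟩ := gamma_lower α hα
  refine ⟨Real.exp 2 / δ, by positivity, ?_⟩
  intro n hn
  have hn0 : (0 : ℝ) < n := by exact_mod_cast hn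
  have hG : 0 < Real.Gamma (n + α + 1) := Real.Gamma_pos_of_pos (by linarith)
  have key : ∀ k ∈ Finset.range (n + 1), |((-1 : ℝ) ^ k / (Nat.factorial k)) *
      (Real.Gamma (n + α + 1) / (Real.Gamma (k + α + 1) * (Nat.factorial (n - k))))| * (1 / (n : ℝ)) ^ k * 2 ^ k
      ≤ (Real.Gamma (n + α + 1) / Nat.factorial n) / δ * (2 ^ k / Nat.factorial k) := by
    intro k hk
    have hk' : k ≤ n := by simpa [Nat.lt_succ_iff] using hk
    have h1 : (Nat.factorial n : ℝ) ≤ (Nat.factorial (n - k)) * n ^ k := by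
      have h := Nat.factorial_mul_descFactorial hk'
      rw [← h]
      push_cast
      gcongr
      exact_mod_cast Nat.descFactorial_le_pow n k
    have hGk : 0 < Real.Gamma (k + α + 1) := lt_of_lt_of_le hδ (hΓ k)
    have e : |((-1 : ℝ) ^ k / (Nat.factorial k)) *
      (Real.Gamma (n + α + 1) / (Real.Gamma (k + α + 1) * (Nat.factorial (n - k))))| =
      (1 / (Nat.factorial k)) *
      (Real.Gamma (n + α + 1) / (Real.Gamma (k + α + 1) * (Nat.factorial (n - k)))) := by
      rw [abs_mul, abs_div, abs_pow, abs_neg, abs_one, one_pow, abs_of_pos (by positivity),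
        abs_of_pos (by positivity)]
    rw [e]
    have h3 : 1 / (Real.Gamma (k + α + 1) * ((Nat.factorial (n - k)) * n ^ k)) ≤
        1 / (δ * Nat.factorial n) := by
      apply one_div_le_one_div_of_le (by positivity)
      exact mul_le_mul (hΓ k) h1 (by positivity) hGk.le
    calc _ = (2 ^ k / Nat.factorial k * Real.Gamma (n + α + 1)) *
          (1 / (Real.Gamma (k + α + 1) * ((Nat.factorial (n - k)) * n ^ k))) := by
          rw [one_div_pow]; field_simp
      _ ≤ (2 ^ k / Nat.factorial k * Real.Gamma (n + α + 1)) * (1 / (δ * Nat.factorial n)) := by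
          gcongr
      _ = _ := by field_simp
  have hsum : ∑ k ∈ Finset.range (n + 1), |((-1 : ℝ) ^ k / (Nat.factorial k)) *
      (Real.Gamma (n + α + 1) / (Real.Gamma (k + α + 1) * (Nat.factorial (n - k))))| * (1 / (n : ℝ)) ^ k * 2 ^ k
      ≤ Real.exp 2 / δ * (Real.Gamma (n + α + 1) / Nat.factorial n) := by
    refine (Finset.sum_le_sum key).trans ?_
    rw [← Finset.mul_sum]
    have := Real.sum_le_exp_of_nonneg (x := 2) (by norm_num) (n + 1)
    calc _ ≤ (Real.Gamma (n + α + 1) / Nat.factorial n) / δ * Real.exp 2 := by gcongr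
      _ = _ := by ring
  constructor
  · refine le_trans ?_ hsum
    rw [lagPoly, Polynomial.eval_finsetSum]
    refine (Finset.abs_sum_le_sum_abs _ _).trans (Finset.sum_le_sum ?_)
    intro k hk
    rw [Polynomial.eval_mul, Polynomial.eval_C, Polynomial.eval_pow, Polynomial.eval_X, abs_mul,
      abs_of_nonneg (show (0 : ℝ) ≤ (1 / (n : ℝ)) ^ k by positivity)]
    exact le_mul_of_one_le_right (by positivity) (one_le_pow₀ (by norm_num))
  · refine le_trans ?_ (mul_le_mul_of_nonneg_right hsum hn0.le)
    rw [lagPoly, Polynomial.derivative_sum, Polynomial.eval_finsetSum, Finset.sum_mul]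
    refine (Finset.abs_sum_le_sum_abs _ _).trans (Finset.sum_le_sum ?_)
    intro k hk
    rw [Polynomial.derivative_C_mul_X_pow, Polynomial.eval_mul, Polynomial.eval_C,
      Polynomial.eval_pow, Polynomial.eval_X, abs_mul, abs_mul,
      abs_of_nonneg (show (0 : ℝ) ≤ (1 / (n : ℝ)) ^ (k - 1) by positivity), mul_assoc, mul_assoc,
      mul_assoc]
    refine mul_le_mul_of_nonneg_left ?_ (abs_nonneg _)
    rcases k with _ | k
    · simp
    · have h2 : ((k + 1 : ℕ) : ℝ) ≤ 2 ^ (k + 1) := by exact_mod_cast (Nat.lt_two_pow_self).le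
      rw [abs_of_nonneg (by positivity), Nat.add_sub_cancel]
      have : (1 / (n : ℝ)) ^ (k + 1) * (2 ^ (k + 1) * n) = 2 ^ (k + 1) * (1 / (n : ℝ)) ^ k := by
        rw [pow_succ (1 / (n : ℝ))]; field_simp
      rw [this]
      gcongr

lemma gamma_ratio (α : ℝ) (hα : -1 < α) : ∃ B > 0, ∃ n0 : ℕ, ∀ n ≥ n0, 1 ≤ n →
    Real.Gamma (n + α + 1) / Nat.factorial n ≤ B * (n : ℝ) ^ α := by
  have hs : 0 < α + 1 := by linarith
  have hG := Real.Gamma_pos_of_pos hs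
  have hp : ∀ n : ℕ, Real.Gamma (n + 1 + (α + 1)) =
      (∏ j ∈ Finset.range (n + 1), (α + 1 + j)) * Real.Gamma (α + 1) := by
    intro n
    induction n with
    | zero => simp [add_comm 1 (α+1)]; rw [Real.Gamma_add_one hs.ne']
    | succ n ih =>
      rw [Finset.prod_range_succ, mul_right_comm, ← ih, mul_comm]
      rw [← show (α + 1 + ((n + 1 : ℕ) : ℝ)) = n + 1 + (α + 1) by push_cast; ring]
      rw [← Real.Gamma_add_one (by positivity)]
      congr 1; push_cast; ring
  have ht := Real.GammaSeq_tendsto_Gamma (α + 1)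
  have hev := ht.eventually (lt_mem_nhds (show Real.Gamma (α + 1) / 2 < Real.Gamma (α + 1) by linarith))
  obtain ⟨n0, hn0⟩ := Filter.eventually_atTop.1 hev
  refine ⟨2, by norm_num, n0, ?_⟩
  intro n hn hn1
  have h := hn0 n hn
  have hnp : (0 : ℝ) < n := by exact_mod_cast hn1
  have hpp : 0 < ∏ j ∈ Finset.range (n + 1), (α + 1 + (j : ℝ)) :=
    Finset.prod_pos fun j _ => by positivity
  rw [Real.GammaSeq, lt_div_iff₀ hpp] at h
  have h2 := hp n
  have h3 : Real.Gamma (n + 1 + (α + 1)) = (n + α + 1) * Real.Gamma (n + α + 1) := by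
    rw [← Real.Gamma_add_one (by linarith)]; congr 1; ring
  rw [div_le_iff₀ (by positivity)]
  have h4 : (n : ℝ) ^ (α + 1) = n ^ α * n := by rw [Real.rpow_add hnp, Real.rpow_one]
  rw [h4] at h
  have h5 : (n + α + 1) * Real.Gamma (n + α + 1) < 2 * (n : ℝ) ^ α * n * Nat.factorial n := by
    rw [← h3, h2]; linarith
  have hG' : 0 < Real.Gamma (n + α + 1) := Real.Gamma_pos_of_pos (by linarith)
  have h6 : n * Real.Gamma (n + α + 1) ≤ n * (2 * (n : ℝ) ^ α * Nat.factorial n) := by nlinarith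
  exact le_of_mul_le_mul_left h6 hnp

/-- Prefactor. -/
noncomputable def lagE (α s : ℝ) : ℝ := Real.exp (-s ^ 2 / 2) * s ^ (α + 1 / 2)

lemma lagE_deriv (α s : ℝ) (hs : 0 < s) :
    HasDerivAt (lagE α) (lagE α s * (-s + (α + 1 / 2) / s)) s := by
  have h1 : HasDerivAt (fun s : ℝ => Real.exp (-s ^ 2 / 2)) (Real.exp (-s ^ 2 / 2) * (-s)) s := by
    have : HasDerivAt (fun s : ℝ => -s ^ 2 / 2) (-s) s := by
      have := ((hasDerivAt_pow 2 s).neg.div_const 2)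
      refine HasDerivAt.congr_deriv this ?_
      simp
      ring
    exact this.exp
  have h2 := Real.hasDerivAt_rpow_const (x := s) (p := α + 1 / 2) (Or.inl hs.ne')
  have h3 := h1.mul h2
  refine HasDerivAt.congr_deriv h3 ?_
  rw [lagE, Real.rpow_sub_one hs.ne']
  field_simp

lemma poly_sq_deriv (P : Polynomial ℝ) (s : ℝ) :
    HasDerivAt (fun s : ℝ => P.eval (s ^ 2)) (P.derivative.eval (s ^ 2) * (2 * s)) s := by
  have h := (P.hasDerivAt (s ^ 2)).comp s (hasDerivAt_pow 2 s)
  refine HasDerivAt.congr_deriv h ?_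
  simp

noncomputable def lagW (α : ℝ) (n : ℕ) (s : ℝ) : ℝ := lagE α s * (lagPoly α n).eval (s ^ 2)

noncomputable def lagW1 (α : ℝ) (n : ℕ) (s : ℝ) : ℝ :=
  lagE α s * ((-s + (α + 1 / 2) / s) * (lagPoly α n).eval (s ^ 2)
    + (lagPoly α n).derivative.eval (s ^ 2) * (2 * s))

lemma lagW_deriv (α : ℝ) (n : ℕ) (s : ℝ) (hs : 0 < s) :
    HasDerivAt (lagW α n) (lagW1 α n s) s := by
  have := (lagE_deriv α s hs).mul (poly_sq_deriv (lagPoly α n) s)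
  refine HasDerivAt.congr_deriv this ?_
  rw [lagW1]; ring

lemma lagW1_deriv (α : ℝ) (hα : -1 < α) (n : ℕ) (s : ℝ) (hs : 0 < s) :
    HasDerivAt (lagW1 α n)
      (-(4 * n + 2 * α + 2 - s ^ 2 + (1 / 4 - α ^ 2) / s ^ 2) * lagW α n s) s := by
  have hq : HasDerivAt (fun s : ℝ => -s + (α + 1 / 2) / s) (-1 - (α + 1 / 2) / s ^ 2) s := by
    have h := (hasDerivAt_id s).neg.add ((hasDerivAt_inv hs.ne').const_mul (α + 1 / 2))
    refine HasDerivAt.congr_deriv h ?_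
    field_simp
    ring
  have h2s : HasDerivAt (fun s : ℝ => 2 * s) 2 s := by
    simpa using (hasDerivAt_id s).const_mul (2 : ℝ)
  have := (lagE_deriv α s hs).mul ((hq.mul (poly_sq_deriv (lagPoly α n) s)).add
    ((poly_sq_deriv (lagPoly α n).derivative s).mul h2s))
  refine HasDerivAt.congr_deriv this ?_
  have ode := congrArg (Polynomial.eval (s ^ 2)) (lagPoly_ode α hα n)
  simp only [Polynomial.eval_add, Polynomial.eval_sub, Polynomial.eval_mul, Polynomial.eval_X,
    Polynomial.eval_C, Polynomial.eval_zero] at ode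
  simp only [lagW, Pi.add_apply, Pi.mul_apply]
  generalize (lagPoly α n).eval (s ^ 2) = P0 at *
  generalize (lagPoly α n).derivative.eval (s ^ 2) = P1 at *
  generalize (lagPoly α n).derivative.derivative.eval (s ^ 2) = P2 at *
  have e : s ^ 2 * P2 = -((α + 1) * P1 - s ^ 2 * P1 + n * P0) := by linarith
  have hs' := hs.ne'
  field_simp
  linear_combination (64 * lagE α s * s ^ 2) * e

lemma lag_energy (α : ℝ) (hα : -1 < α) (n : ℕ) (hn : 1 ≤ n) (s0 S : ℝ) (h0 : 0 < s0) (hS : s0 ≤ S) :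
    (lagW1 α n S ^ 2 + (4 * n + 2 * α + 2) * lagW α n S ^ 2) ≤
    (lagW1 α n s0 ^ 2 + (4 * n + 2 * α + 2) * lagW α n s0 ^ 2) *
      Real.exp (1 / (2 * √n) * (S ^ 3 / 3 + |1 / 4 - α ^ 2| / s0)) := by
  set c := 1 / 4 - α ^ 2 with hc
  set K : ℝ := 4 * n + 2 * α + 2 with hK
  have hn0 : (0 : ℝ) < n := by exact_mod_cast hn
  have hK4 : 4 * n ≤ K := by rw [hK]; linarith
  set k := 1 / (2 * √n) with hk
  have hkpos : 0 < k := by positivity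
  set G : ℝ → ℝ := fun s => k * (s ^ 3 / 3 - |c| / s) with hG
  set F : ℝ → ℝ := fun s => lagW1 α n s ^ 2 + K * lagW α n s ^ 2 with hF
  have hGd : ∀ s, 0 < s → HasDerivAt G (k * (s ^ 2 + |c| / s ^ 2)) s := by
    intro s hs
    have h := (((hasDerivAt_pow 3 s).div_const 3).sub ((hasDerivAt_inv hs.ne').const_mul |c|)).const_mul k
    refine HasDerivAt.congr_deriv h ?_
    field_simp
    simp
    ring
  have hFd : ∀ s, 0 < s → HasDerivAt F (2 * lagW1 α n s * lagW α n s * (s ^ 2 - c / s ^ 2)) s := by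
    intro s hs
    have h := ((lagW1_deriv α hα n s hs).pow 2).add (((lagW_deriv α n s hs).pow 2).const_mul K)
    refine HasDerivAt.congr_deriv h ?_
    rw [hK, hc]
    push_cast
    ring
  have hHd : ∀ s, 0 < s → HasDerivAt (fun s => F s * Real.exp (-G s))
      ((2 * lagW1 α n s * lagW α n s * (s ^ 2 - c / s ^ 2) - F s * (k * (s ^ 2 + |c| / s ^ 2))) *
        Real.exp (-G s)) s := by
    intro s hs
    have h := (hFd s hs).mul (hGd s hs).neg.exp
    refine HasDerivAt.congr_deriv h ?_
    simp only [Pi.neg_apply]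
    ring
  have hanti : AntitoneOn (fun s => F s * Real.exp (-G s)) (Set.Icc s0 S) := by
    apply antitoneOn_of_deriv_nonpos (convex_Icc _ _)
    · intro s hs
      exact (hHd s (h0.trans_le hs.1)).continuousAt.continuousWithinAt
    · intro s hs
      rw [interior_Icc] at hs
      exact (hHd s (h0.trans hs.1)).differentiableAt.differentiableWithinAt
    · intro s hs
      rw [interior_Icc] at hs
      have hs0 := h0.trans hs.1
      rw [(hHd s hs0).deriv]
      refine mul_nonpos_of_nonpos_of_nonneg ?_ (Real.exp_pos _).le
      have a1 : |2 * lagW1 α n s * lagW α n s| ≤ F s * k := by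
        rw [hk, mul_one_div, le_div_iff₀ (by positivity), abs_mul, abs_mul, abs_two]
        have hsq : √(n : ℝ) ^ 2 = n := Real.sq_sqrt hn0.le
        have := sq_nonneg (|lagW1 α n s| - 2 * √n * |lagW α n s|)
        have e1 := sq_abs (lagW1 α n s)
        have e2 := sq_abs (lagW α n s)
        have e3 : 4 * n * lagW α n s ^ 2 ≤ K * lagW α n s ^ 2 := by gcongr
        have e4 : (2 * √(n : ℝ) * |lagW α n s|) ^ 2 = 4 * n * lagW α n s ^ 2 := by
          rw [mul_pow, mul_pow, hsq, e2]; ring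
        simp only [hF]
        nlinarith
      have a2 : |s ^ 2 - c / s ^ 2| ≤ s ^ 2 + |c| / s ^ 2 := by
        refine (abs_sub _ _).trans ?_
        rw [abs_div, abs_of_nonneg (sq_nonneg s)]
      have a3 : 2 * lagW1 α n s * lagW α n s * (s ^ 2 - c / s ^ 2) ≤
          F s * k * (s ^ 2 + |c| / s ^ 2) := by
        refine (le_abs_self _).trans ?_
        rw [abs_mul]
        exact mul_le_mul a1 a2 (abs_nonneg _) ((abs_nonneg _).trans a1)
      linarith
  have hfin := hanti (Set.left_mem_Icc.2 hS) (Set.right_mem_Icc.2 hS) hS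
  simp only at hfin
  have hF0 : 0 ≤ F s0 := by 
    have hK0 : 0 ≤ K := by linarith
    simp only [hF]
    positivity
  have hSp : 0 < S := h0.trans_le hS
  calc F S = F S * Real.exp (-G S) * Real.exp (G S) := by
        rw [mul_assoc, ← Real.exp_add]; simp
    _ ≤ F s0 * Real.exp (-G s0) * Real.exp (G S) := by gcongr
    _ = F s0 * Real.exp (G S - G s0) := by rw [mul_assoc, ← Real.exp_add]; ring_nf
    _ ≤ _ := by
        apply mul_le_mul_of_nonneg_left _ hF0
        apply Real.exp_le_exp.2
        simp only [hG]
        rw [← mul_sub]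
        apply mul_le_mul_of_nonneg_left _ hkpos.le
        have : 0 ≤ |c| / S := by positivity
        have : 0 ≤ s0 ^ 3 := by positivity
        linarith

set_option maxHeartbeats 1000000 in
lemma lagPhi_bound (α : ℝ) (hα : -1 < α) (x : ℝ) (hx : 0 < x) :
    ∃ C : ℝ, ∃ n0 : ℕ, ∀ n ≥ n0, 1 ≤ n → lagPhi α n x ^ 2 ≤ C / √n := by
  obtain ⟨A, hA, hAb⟩ := lagPoly_bounds α hα
  obtain ⟨B, hB, n1, hBb⟩ := gamma_ratio α hα
  obtain ⟨n2, hn2⟩ := exists_nat_ge (1 / x)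
  set S := √x with hS
  have hSp : 0 < S := Real.sqrt_pos.2 hx
  have hSx : S ^ 2 = x := Real.sq_sqrt hx.le
  set ν := α + 1 / 2 with hν
  set D := A ^ 2 * ((3 + |ν|) ^ 2 + (4 + 2 * (α + 1))) with hD
  set X := Real.exp (1 / 2 * (S ^ 3 / 3 + |1 / 4 - α ^ 2|)) with hX
  have hEpos : 0 < lagE α S := by rw [lagE]; positivity
  refine ⟨D * X * B / lagE α S ^ 2, max n1 n2, ?_⟩
  intro n hn hn1
  have hn0 : (0 : ℝ) < n := by exact_mod_cast hn1
  have hn1' : (1 : ℝ) ≤ n := by exact_mod_cast hn1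
  obtain ⟨hv, hd⟩ := hAb n hn1
  have hh := hBb n ((le_max_left _ _).trans hn) hn1
  set h := Real.Gamma (n + α + 1) / Nat.factorial n with hhdef
  have hGp : 0 < Real.Gamma (n + α + 1) := Real.Gamma_pos_of_pos (by linarith)
  have hpos : 0 < h := by positivity
  have hsn : 0 < √(n : ℝ) := Real.sqrt_pos.2 hn0
  have hsn1 : 1 ≤ √(n : ℝ) := Real.one_le_sqrt.2 hn1'
  have hsq : √(n : ℝ) ^ 2 = n := Real.sq_sqrt hn0.le
  obtain ⟨s0, hs0⟩ : ∃ s0, s0 = 1 / √(n : ℝ) := ⟨_, rfl⟩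
  have hs0p : 0 < s0 := by rw [hs0]; positivity
  have hs0sq : s0 ^ 2 = 1 / n := by rw [hs0, div_pow, hsq, one_pow]
  have hs0S : s0 ≤ S := by
    apply le_of_sq_le_sq _ hSp.le
    rw [hs0sq, hSx]
    rw [div_le_iff₀ hn0]
    have : (n2 : ℝ) ≤ n := by exact_mod_cast (le_max_right _ _).trans hn
    have := hn2.trans this
    rw [div_le_iff₀ hx] at this
    linarith
  have en := lag_energy α hα n hn1 s0 S hs0p hs0S
  have hexp : Real.exp (1 / (2 * √n) * (S ^ 3 / 3 + |1 / 4 - α ^ 2| / s0)) ≤ X := by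
    apply Real.exp_le_exp.2
    have e1 : 1 / (2 * √(n : ℝ)) * (S ^ 3 / 3 + |1 / 4 - α ^ 2| / s0) =
      1 / 2 * ((S ^ 3 / 3) / √n + |1 / 4 - α ^ 2|) := by
      rw [hs0]; field_simp
    rw [e1]
    have : S ^ 3 / 3 / √n ≤ S ^ 3 / 3 := div_le_self (by positivity) hsn1
    gcongr
  have hE0 : lagE α s0 ≤ s0 ^ ν := by
    rw [lagE]
    apply mul_le_of_le_one_left (by positivity)
    apply Real.exp_le_one_iff.2
    have := sq_nonneg s0
    linarith
  have hE0p : 0 < lagE α s0 := by rw [lagE]; positivity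
  have b0 : lagW α n s0 ^ 2 ≤ lagE α s0 ^ 2 * (A * h) ^ 2 := by
    rw [lagW, mul_pow, hs0sq]
    refine mul_le_mul_of_nonneg_left ?_ (sq_nonneg _)
    exact sq_le_sq' (by linarith [neg_abs_le ((lagPoly α n).eval (1 / (n : ℝ)))]) ((le_abs_self _).trans hv)
  have b1 : lagW1 α n s0 ^ 2 ≤ lagE α s0 ^ 2 * (A * h * √n * (3 + |ν|)) ^ 2 := by
    rw [lagW1, mul_pow, hs0sq]
    refine mul_le_mul_of_nonneg_left ?_ (sq_nonneg _)
    apply sq_le_sq.2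
    rw [abs_of_nonneg (show 0 ≤ A * h * √n * (3 + |ν|) by positivity)]
    refine (abs_add_le _ _).trans ?_
    rw [abs_mul, abs_mul, abs_of_pos (show 0 < 2 * s0 by positivity)]
    have c1 : |-s0 + ν / s0| ≤ √n * (1 + |ν|) := by
      refine (abs_add_le _ _).trans ?_
      rw [abs_neg, abs_div, abs_of_pos hs0p]
      have : |ν| / s0 = √n * |ν| := by rw [hs0]; field_simp
      rw [this]
      have : s0 ≤ 1 := by rw [hs0, div_le_one hsn]; exact hsn1
      nlinarith
    have c2 : A * h * n * (2 * s0) = A * h * √n * 2 := by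
      rw [hs0]; nth_rewrite 1 [← hsq]; field_simp
    calc _ ≤ √n * (1 + |ν|) * (A * h) + A * h * n * (2 * s0) := by gcongr
      _ = A * h * √n * (3 + |ν|) := by rw [c2]; ring
  have hK : (4 * n + 2 * α + 2 : ℝ) ≤ (4 + 2 * (α + 1)) * n := by
    have := mul_le_mul_of_nonneg_left hn1' (show 0 ≤ α + 1 by linarith)
    linarith
  have hKp : (4 * n : ℝ) ≤ 4 * n + 2 * α + 2 := by linarith
  have bF : lagW1 α n s0 ^ 2 + (4 * n + 2 * α + 2) * lagW α n s0 ^ 2 ≤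
      lagE α s0 ^ 2 * (D * h ^ 2 * n) := by
    calc _ ≤ lagE α s0 ^ 2 * (A * h * √n * (3 + |ν|)) ^ 2 +
          ((4 + 2 * (α + 1)) * n) * (lagE α s0 ^ 2 * (A * h) ^ 2) := by
          have : 0 < 4 + 2 * (α + 1) := by linarith
          gcongr
      _ = _ := by rw [hD, mul_pow _ (3 + |ν|), mul_pow _ (√(n : ℝ)), hsq]; ring
  have hDp : 0 ≤ D := by
    have : 0 < 4 + 2 * (α + 1) := by linarith
    positivity
  have hEs : lagE α s0 ^ 2 ≤ (n : ℝ) ^ (-α) / √n := by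
    calc lagE α s0 ^ 2 ≤ (s0 ^ ν) ^ 2 := by gcongr
      _ = (n : ℝ) ^ (-α) / √n := by
        rw [hs0, Real.sqrt_eq_rpow, one_div, ← Real.rpow_neg hn0.le, ← Real.rpow_mul hn0.le,
          ← Real.rpow_natCast, ← Real.rpow_mul hn0.le, ← Real.rpow_sub hn0]
        congr 1
        rw [hν]; push_cast; ring
  have hWS : n * (lagE α S ^ 2 * (genLaguerre α n x) ^ 2) ≤ n * ((n : ℝ) ^ (-α) / √n * (D * h ^ 2) * X) := by
    calc n * (lagE α S ^ 2 * (genLaguerre α n x) ^ 2) = n * lagW α n S ^ 2 := by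
          rw [lagW, mul_pow, hSx, lagPoly_eval]
      _ ≤ lagW1 α n S ^ 2 + (4 * n + 2 * α + 2) * lagW α n S ^ 2 := by
          have := sq_nonneg (lagW1 α n S)
          have : n * lagW α n S ^ 2 ≤ (4 * n + 2 * α + 2) * lagW α n S ^ 2 := by
            gcongr; linarith
          linarith
      _ ≤ _ := en
      _ ≤ (lagE α s0 ^ 2 * (D * h ^ 2 * n)) * X := by
          gcongr
      _ ≤ ((n : ℝ) ^ (-α) / √n * (D * h ^ 2 * n)) * X := by gcongr
      _ = _ := by ring
  have hWS' := le_of_mul_le_mul_left hWS hn0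
  have hphi : lagPhi α n x ^ 2 = (1 / h) * genLaguerre α n x ^ 2 := by
    rw [lagPhi, mul_pow, Real.sq_sqrt (by positivity), hhdef, one_div_div]
  rw [hphi]
  have hE2 : 0 < lagE α S ^ 2 := by positivity
  have : (1 / h) * genLaguerre α n x ^ 2 ≤ (n : ℝ) ^ (-α) / √n * (D * h) * X / lagE α S ^ 2 := by
    rw [le_div_iff₀ hE2]
    calc _ = (1 / h) * (lagE α S ^ 2 * (genLaguerre α n x) ^ 2) := by ring
      _ ≤ (1 / h) * ((n : ℝ) ^ (-α) / √n * (D * h ^ 2) * X) := by gcongr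
      _ = _ := by field_simp
  refine this.trans ?_
  have hXp : 0 < X := Real.exp_pos _
  calc _ ≤ (n : ℝ) ^ (-α) / √n * (D * (B * (n : ℝ) ^ α)) * X / lagE α S ^ 2 := by gcongr
    _ = ((n : ℝ) ^ (-α) * (n : ℝ) ^ α) * (D * X * B / lagE α S ^ 2 / √n) := by ring
    _ = _ := by rw [← Real.rpow_add hn0]; simp

lemma gamCoef_pos (β η : ℝ) (hβ : 0 < β) (hη : 0 < η) (n : ℕ) : 0 < gamCoef β η n := by
  unfold gamCoef
  have h1 := Real.Gamma_pos_of_pos hη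
  have h2 : 0 < Real.Gamma (β + n) := Real.Gamma_pos_of_pos (by positivity)
  have h3 : 0 < Real.Gamma (β + η + n) := Real.Gamma_pos_of_pos (by positivity)
  positivity

lemma gamCoef_tel (β η : ℝ) (hβ : 0 < β) (hη : 0 < η) (n : ℕ) :
    gamCoef β η n / (β + η + n) = (gamCoef β η n - gamCoef β η (n + 1)) / η := by
  unfold gamCoef
  have h3 : 0 < Real.Gamma (β + η + n) := Real.Gamma_pos_of_pos (by positivity)
  have p1 : 0 < β + n := by positivity
  have p2 : 0 < β + η + n := by positivity
  have e1 : Real.Gamma (β + ((n + 1 : ℕ) : ℝ)) = (β + n) * Real.Gamma (β + n) := by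
    rw [← Real.Gamma_add_one p1.ne']; push_cast; congr 1; ring
  have e2 : Real.Gamma (β + η + ((n + 1 : ℕ) : ℝ)) = (β + η + n) * Real.Gamma (β + η + n) := by
    rw [← Real.Gamma_add_one p2.ne']; push_cast; congr 1; ring
  rw [e1, e2]
  field_simp
  ring

lemma gamCoef_summable (β η : ℝ) (hβ : 0 < β) (hη : 0 < η) :
    Summable (fun n : ℕ => gamCoef β η n / (β + η + n)) := by
  refine summable_of_sum_range_le (c := gamCoef β η 0 / η) ?_ ?_
  · intro n
    have := gamCoef_pos β η hβ hη n
    positivity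
  · intro n
    simp_rw [gamCoef_tel β η hβ hη]
    rw [← Finset.sum_div, Finset.sum_range_sub']
    have := gamCoef_pos β η hβ hη n
    gcongr
    linarith

lemma coef_sq_bound (α x y : ℝ) (hα : -1 < α) (hx : 0 < x) (hy : 0 < y) :
    ∃ C : ℝ, ∃ n0 : ℕ, 0 ≤ C ∧ ∀ n ≥ n0, 1 ≤ n → (lagPhi α n x * lagPhi α n y) ^ 2 ≤ C / n := by
  obtain ⟨C1, n1, h1⟩ := lagPhi_bound α hα x hx
  obtain ⟨C2, n2, h2⟩ := lagPhi_bound α hα y hy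
  refine ⟨|C1 * C2|, max n1 n2, abs_nonneg _, ?_⟩
  intro n hn hn1
  have a1 := h1 n ((le_max_left _ _).trans hn) hn1
  have a2 := h2 n ((le_max_right _ _).trans hn) hn1
  rw [mul_pow]
  calc _ ≤ (C1 / √n) * (C2 / √n) := mul_le_mul a1 a2 (sq_nonneg _) ((sq_nonneg _).trans a1)
    _ = (C1 * C2) / n := by
      rw [div_mul_div_comm, Real.mul_self_sqrt (Nat.cast_nonneg n)]
    _ ≤ _ := by gcongr; exact le_abs_self _

lemma coef_summable (α β η x y : ℝ) (hα : -1 < α) (hβ : 0 < β) (hη : 0 < η)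
    (hx : 0 < x) (hy : 0 < y) :
    Summable (fun n : ℕ => (lagPhi α n x * lagPhi α n y) ^ 2 * gamCoef β η n) := by
  obtain ⟨C, n0, hC, h⟩ := coef_sq_bound α x y hα hx hy
  have hs := (gamCoef_summable β η hβ hη).mul_left (C * (β + η + 1))
  refine Summable.of_norm_bounded_eventually_nat hs ?_
  filter_upwards [Filter.eventually_ge_atTop n0, Filter.eventually_ge_atTop 1] with n hn hn1
  have hg := gamCoef_pos β η hβ hη n
  have hn0 : (1 : ℝ) ≤ n := by exact_mod_cast hn1
  rw [Real.norm_of_nonneg (by positivity)]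
  have h2 : 1 / (n : ℝ) ≤ (β + η + 1) / (β + η + n) := by
    rw [div_le_div_iff₀ (by positivity) (by positivity)]
    nlinarith
  calc _ ≤ C / n * gamCoef β η n := by gcongr; exact h n hn hn1
    _ = C * gamCoef β η n * (1 / n) := by ring
    _ ≤ C * gamCoef β η n * ((β + η + 1) / (β + η + n)) := by gcongr
    _ = _ := by ring

lemma coef_pow_summable (α x y : ℝ) (hα : -1 < α) (hx : 0 < x) (hy : 0 < y) (z : ℂ) (hz : ‖z‖ < 1) :
    Summable (fun n : ℕ => (lagPhi α n x * lagPhi α n y) • z ^ n) := by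
  obtain ⟨C, n0, hC, h⟩ := coef_sq_bound α x y hα hx hy
  have hs := (summable_geometric_of_lt_one (norm_nonneg z) hz).mul_left (1 + C)
  refine Summable.of_norm_bounded_eventually_nat hs ?_
  filter_upwards [Filter.eventually_ge_atTop n0, Filter.eventually_ge_atTop 1] with n hn hn1
  have hn0 : (1 : ℝ) ≤ n := by exact_mod_cast hn1
  rw [norm_smul, norm_pow, Real.norm_eq_abs]
  gcongr
  have h1 := (h n hn hn1).trans (div_le_self hC hn0)
  rw [← sq_abs] at h1
  nlinarith [sq_nonneg (|lagPhi α n x * lagPhi α n y| - 1), abs_nonneg (lagPhi α n x * lagPhi α n y)]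

/-- The Beta integral with a cut-off. -/
lemma beta_cut (β η : ℝ) (hβ : 0 < β) (hη : 0 < η) (m : ℕ) :
    ∫ t in Set.Ioi (0 : ℝ), (if t < 1 then weightBeta β η t else 0) * t ^ m = gamCoef β η m := by
  have h1 : ∫ t in Set.Ioi (0 : ℝ), (if t < 1 then weightBeta β η t else 0) * t ^ m =
      ∫ t in Set.Ioo (0 : ℝ) 1, t ^ (β + m - 1) * (1 - t) ^ (η - 1) := by
    rw [← integral_indicator measurableSet_Ioi, ← integral_indicator measurableSet_Ioo]
    congr 1
    ext t
    simp only [Set.indicator_apply, Set.mem_Ioi, Set.mem_Ioo]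
    by_cases h0 : 0 < t
    · by_cases h1 : t < 1
      · simp only [h0, h1, and_self, if_true, weightBeta]
        rw [show β + m - 1 = (β - 1) + m by ring, Real.rpow_add h0, Real.rpow_natCast]
        ring
      · simp [h0, h1]
    · simp [h0]
  have hp : 0 < β + m := by positivity
  have hb : (ProbabilityTheory.beta (β + m) η) = gamCoef β η m := by
    rw [ProbabilityTheory.beta, gamCoef, add_right_comm, mul_comm]
  rw [h1, ← hb, ProbabilityTheory.beta_eq_betaIntegralReal _ _ hp hη, Complex.betaIntegral,
    ← integral_Ioc_eq_integral_Ioo, ← intervalIntegral.integral_of_le zero_le_one]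
  rw [← Complex.ofReal_re (∫ t in (0 : ℝ)..1, _), ← intervalIntegral.integral_ofReal]
  congr 1
  apply intervalIntegral.integral_congr
  intro t ht
  rw [Set.uIcc_of_le zero_le_one] at ht
  simp only
  rw [Complex.ofReal_mul, Complex.ofReal_cpow ht.1, Complex.ofReal_cpow (sub_nonneg.2 ht.2)]
  push_cast
  rfl

lemma radial_int (β η : ℝ) (hβ : 0 < β) (hη : 0 < η) (m : ℕ) :
    ∫ r in Set.Ioi (0 : ℝ), r * (if r < 1 then weightBeta β η (r ^ 2) else 0) * r ^ (m + m)
      = gamCoef β η m / 2 := by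
  have h := integral_comp_rpow_Ioi_of_pos
    (g := fun t : ℝ => (if t < 1 then weightBeta β η t else 0) * t ^ m) (p := 2) (by norm_num)
  rw [beta_cut β η hβ hη m] at h
  rw [← h, div_eq_mul_inv, ← integral_mul_const]
  apply setIntegral_congr_fun measurableSet_Ioi
  intro r hr
  have hr : 0 < r := hr
  have e : (r ^ 2 < 1) ↔ r < 1 := by
    constructor
    · intro h; nlinarith
    · intro h; nlinarith
  have e2 : (2 : ℝ) - 1 = 1 := by norm_num
  simp only [smul_eq_mul, Real.rpow_two, e, e2, Real.rpow_one]
  ring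

lemma ang_int (m k : ℕ) : ∫ θ in Set.Ioo (-π) π, Complex.exp ((((m : ℤ) - k : ℤ) : ℂ) * Complex.I * θ)
    = if m = k then 2 * (π : ℂ) else 0 := by
  rw [← integral_Ioc_eq_integral_Ioo, ← intervalIntegral.integral_of_le (by linarith [Real.pi_pos])]
  split_ifs with h
  · subst h
    simp
    norm_cast
    ring
  · have hc : (((m : ℤ) - k : ℤ) : ℂ) * Complex.I ≠ 0 := by
      apply mul_ne_zero _ Complex.I_ne_zero
      exact Int.cast_ne_zero.2 (by omega)
    rw [integral_exp_mul_complex hc]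
    have : Complex.exp ((((m : ℤ) - k : ℤ) : ℂ) * Complex.I * (π : ℝ)) =
        Complex.exp ((((m : ℤ) - k : ℤ) : ℂ) * Complex.I * ((-π : ℝ) : ℂ)) := by
      rw [Complex.exp_eq_exp_iff_exists_int]
      refine ⟨(m : ℤ) - k, ?_⟩
      push_cast
      ring
    rw [this, sub_self, zero_div]

lemma disc_meas : MeasurableSet {p : ℝ × ℝ | p.1 ^ 2 + p.2 ^ 2 < 1} :=
  measurableSet_lt (by fun_prop) (by fun_prop)

lemma disc_moment (β η : ℝ) (hβ : 0 < β) (hη : 0 < η) (m k : ℕ) :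
    ∫ p in {p : ℝ × ℝ | p.1 ^ 2 + p.2 ^ 2 < 1}, weightBeta β η (p.1 ^ 2 + p.2 ^ 2) •
      (((p.1 : ℂ) + p.2 * Complex.I) ^ m * (starRingEnd ℂ ((p.1 : ℂ) + p.2 * Complex.I)) ^ k) =
    if m = k then ((π * gamCoef β η m : ℝ) : ℂ) else 0 := by
  rw [← integral_indicator disc_meas, ← integral_comp_polarCoord_symm]
  have hcongr : ∀ p ∈ polarCoord.target, p.1 • (Set.indicator {p : ℝ × ℝ | p.1 ^ 2 + p.2 ^ 2 < 1}
      (fun p => weightBeta β η (p.1 ^ 2 + p.2 ^ 2) •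
      (((p.1 : ℂ) + p.2 * Complex.I) ^ m * (starRingEnd ℂ ((p.1 : ℂ) + p.2 * Complex.I)) ^ k))
        (polarCoord.symm p)) =
      (((p.1 * (if p.1 < 1 then weightBeta β η (p.1 ^ 2) else 0) * p.1 ^ (m + k) : ℝ)) : ℂ) *
        Complex.exp ((((m : ℤ) - k : ℤ) : ℂ) * Complex.I * p.2) := by
    rintro ⟨r, θ⟩ hp
    have hr : 0 < r := hp.1
    have e0 : (r * Real.cos θ) ^ 2 + (r * Real.sin θ) ^ 2 = r ^ 2 := by
      rw [mul_pow, mul_pow, ← mul_add, Real.cos_sq_add_sin_sq, mul_one]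
    have e : (r ^ 2 < 1) ↔ r < 1 := by
      constructor
      · intro h; nlinarith
      · intro h; nlinarith
    have ez : (((r * Real.cos θ : ℝ) : ℂ) + ((r * Real.sin θ : ℝ) : ℂ) * Complex.I) =
        r * Complex.exp (θ * Complex.I) := by
      rw [Complex.exp_mul_I]; push_cast; ring
    have ezc : starRingEnd ℂ (r * Complex.exp (θ * Complex.I)) =
        r * Complex.exp (-(θ * Complex.I)) := by
      rw [map_mul, ← Complex.exp_conj, map_mul, Complex.conj_ofReal, Complex.conj_ofReal,
        Complex.conj_I, mul_neg]
    simp only [polarCoord_symm_apply, Set.indicator_apply, Set.mem_ofPred_eq, e0, e, ez, ezc]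
    by_cases h1 : r < 1
    · simp only [h1, if_true, Complex.real_smul]
      rw [mul_pow, mul_pow, ← Complex.exp_nat_mul, ← Complex.exp_nat_mul]
      have : Complex.exp ((((m : ℤ) - k : ℤ) : ℂ) * Complex.I * θ) =
          Complex.exp (m * (θ * Complex.I)) * Complex.exp (k * -(θ * Complex.I)) := by
        rw [← Complex.exp_add]; congr 1; push_cast; ring
      rw [this]
      push_cast
      ring
    · simp [h1]
  rw [setIntegral_congr_fun polarCoord.open_target.measurableSet hcongr, polarCoord_target,
    Measure.volume_eq_prod, setIntegral_prod_mul
      (fun r : ℝ => (((r * (if r < 1 then weightBeta β η (r ^ 2) else 0) * r ^ (m + k) : ℝ)) : ℂ))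
      (fun θ : ℝ => Complex.exp ((((m : ℤ) - k : ℤ) : ℂ) * Complex.I * θ)), ang_int]
  split_ifs with h
  · subst h
    rw [integral_complex_ofReal, radial_int β η hβ hη]
    push_cast
    ring
  · simp

open Filter Topology in
lemma l2_lim {Y : Type*} [MeasurableSpace Y] (μ : Measure Y) [IsFiniteMeasure μ]
    (e : ℕ → Y → ℂ) (he : ∀ k, AEStronglyMeasurable (e k) μ) (hb : ∀ k, ∀ᵐ p ∂μ, ‖e k p‖ ≤ 1)
    (g c : ℕ → ℝ) (hg : ∀ k, 0 ≤ g k)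
    (horth : ∀ m k, ∫ p, e m p * starRingEnd ℂ (e k p) ∂μ = if m = k then (g m : ℂ) else 0)
    (hc : Summable (fun k => c k ^ 2 * g k)) (hs : ∀ᵐ p ∂μ, Summable (fun k => c k • e k p)) (n : ℕ) :
    Integrable (fun p => (∑' k, c k • e k p) * starRingEnd ℂ (e n p)) μ ∧
    ∫ p, (∑' k, c k • e k p) * starRingEnd ℂ (e n p) ∂μ = ((c n * g n : ℝ) : ℂ) := by
  set f : Y → ℂ := fun p => ∑' k, c k • e k p with hf
  set S : ℕ → Y → ℂ := fun N p => ∑ k ∈ Finset.range N, c k • e k p with hS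
  have hconj : ∀ k, AEStronglyMeasurable (fun p => starRingEnd ℂ (e k p)) μ := fun k =>
    Complex.continuous_conj.comp_aestronglyMeasurable (he k)
  have hmemE : ∀ k, MemLp (e k) 2 μ := fun k => MemLp.of_bound (he k) 1 (hb k)
  have hIntg : ∀ m k, Integrable (fun p => e m p * starRingEnd ℂ (e k p)) μ := by
    intro m k
    refine Integrable.of_bound ((he m).mul (hconj k)) 1 ?_
    filter_upwards [hb m, hb k] with p h1 h2
    rw [norm_mul, RCLike.norm_conj]
    exact mul_le_one₀ h1 (norm_nonneg _) h2
  have hSmem : ∀ N, MemLp (S N) 2 μ := by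
    intro N
    exact memLp_finsetSum _ (fun k _ => (hmemE k).const_smul (c k))
  have hlim : ∀ᵐ p ∂μ, Tendsto (fun N => S N p) atTop (𝓝 (f p)) := by
    filter_upwards [hs] with p hp
    exact hp.hasSum.tendsto_sum_nat
  have hfm : AEStronglyMeasurable f μ :=
    aestronglyMeasurable_of_tendsto_ae atTop (fun N => (hSmem N).1) hlim
  set T : ℕ → ℝ := fun N => ∑' k, c (k + N) ^ 2 * g (k + N) with hT
  have hTnn : ∀ N, 0 ≤ T N := fun N => tsum_nonneg fun k => mul_nonneg (sq_nonneg _) (hg _)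
  have hT0 : Tendsto T atTop (𝓝 0) := tendsto_sum_nat_add (fun k => c k ^ 2 * g k)
  have hsq : ∀ s : Finset ℕ, ∫ p, ‖∑ k ∈ s, c k • e k p‖ ^ 2 ∂μ = ∑ k ∈ s, c k ^ 2 * g k := by
    intro s
    have h1 : ∀ p, ((‖∑ k ∈ s, c k • e k p‖ ^ 2 : ℝ) : ℂ) =
        ∑ j ∈ s, ∑ k ∈ s, ((c j * c k : ℝ) : ℂ) * (e j p * starRingEnd ℂ (e k p)) := by
      intro p
      rw [Complex.ofReal_pow, ← Complex.mul_conj', map_sum, Finset.sum_mul_sum]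
      refine Finset.sum_congr rfl fun j _ => Finset.sum_congr rfl fun k _ => ?_
      simp only [Complex.real_smul, map_mul, Complex.conj_ofReal]
      push_cast
      ring
    have h2 : ((∫ p, ‖∑ k ∈ s, c k • e k p‖ ^ 2 ∂μ : ℝ) : ℂ) = ((∑ k ∈ s, c k ^ 2 * g k : ℝ) : ℂ) := by
      rw [← integral_complex_ofReal]
      simp_rw [h1]
      rw [integral_finsetSum _ (fun j _ => integrable_finsetSum _ fun k _ => (hIntg j k).const_mul _)]
      rw [Complex.ofReal_sum]
      refine Finset.sum_congr rfl fun j hj => ?_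
      rw [integral_finsetSum _ (fun k _ => (hIntg j k).const_mul _)]
      simp_rw [integral_const_mul, horth]
      simp only [mul_ite, mul_zero, Finset.sum_ite_eq, hj, if_true]
      push_cast
      ring
    exact_mod_cast h2
  have hdiff : ∀ N M, N ≤ M → eLpNorm (S M - S N) 2 μ ≤ ENNReal.ofReal (√(T N)) := by
    intro N M hNM
    rw [MemLp.eLpNorm_eq_integral_rpow_norm (by norm_num) (by norm_num) ((hSmem M).sub (hSmem N))]
    apply ENNReal.ofReal_le_ofReal
    have e1 : ∀ p, (S M - S N) p = ∑ k ∈ Finset.Ico N M, c k • e k p := by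
      intro p
      rw [Pi.sub_apply, Finset.sum_Ico_eq_sub _ hNM]
    simp only [ENNReal.toReal_ofNat, Real.rpow_two, e1, hsq]
    rw [Real.sqrt_eq_rpow, one_div]
    refine Real.rpow_le_rpow (Finset.sum_nonneg fun k _ => mul_nonneg (sq_nonneg _) (hg _)) ?_ (by norm_num)
    rw [Finset.sum_Ico_eq_sum_range]
    simp only [add_comm N]
    exact ((summable_nat_add_iff N).2 hc).sum_le_tsum _ (fun k _ => mul_nonneg (sq_nonneg _) (hg _))
  have hfS : ∀ N, eLpNorm (f - S N) 2 μ ≤ ENNReal.ofReal (√(T N)) := by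
    intro N
    refine (Lp.eLpNorm_lim_le_liminf_eLpNorm (f := fun M => S M - S N)
      (fun M => ((hSmem M).sub (hSmem N)).1) (f - S N) ?_).trans ?_
    · filter_upwards [hlim] with p hp
      exact hp.sub_const _
    · refine liminf_le_of_frequently_le' (Eventually.frequently ?_)
      filter_upwards [eventually_ge_atTop N] with M hM using hdiff N M hM
  have hfmem : MemLp f 2 μ := by
    refine ⟨hfm, ?_⟩
    have h0 := hfS 0
    have : f - S 0 = f := by ext p; simp [hS]
    rw [this] at h0
    exact h0.trans_lt ENNReal.ofReal_lt_top
  have hmulint : ∀ h : Y → ℂ, MemLp h 2 μ → Integrable (fun p => h p * starRingEnd ℂ (e n p)) μ := by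
    intro h hh
    refine (hh.integrable (by norm_num)).mul_bdd (c := 1) (hconj n) ?_
    filter_upwards [hb n] with p hp
    rwa [RCLike.norm_conj]
  refine ⟨hmulint f hfmem, ?_⟩
  have hL1 : Tendsto (fun N => eLpNorm ((fun p => S N p * starRingEnd ℂ (e n p)) -
      (fun p => f p * starRingEnd ℂ (e n p))) 1 μ) atTop (𝓝 0) := by
    have hbound : ∀ N, eLpNorm ((fun p => S N p * starRingEnd ℂ (e n p)) -
      (fun p => f p * starRingEnd ℂ (e n p))) 1 μ ≤ ENNReal.ofReal (√(T N)) *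
        μ Set.univ ^ (1 / (1 : ENNReal).toReal - 1 / (2 : ENNReal).toReal) := by
      intro N
      calc _ ≤ eLpNorm (f - S N) 1 μ := by
            apply eLpNorm_mono_ae
            filter_upwards [hb n] with p hp
            rw [Pi.sub_apply, Pi.sub_apply, ← sub_mul, norm_mul, RCLike.norm_conj, norm_sub_rev]
            exact mul_le_of_le_one_right (norm_nonneg _) hp
        _ ≤ _ := eLpNorm_le_eLpNorm_mul_rpow_measure_univ (p := 1) (q := 2) (by norm_num)
            (hfm.sub (hSmem N).1)
        _ ≤ _ := by gcongr; exact hfS N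
    refine tendsto_of_tendsto_of_tendsto_of_le_of_le tendsto_const_nhds ?_ (fun _ => zero_le) hbound
    have h1 : Tendsto (fun N => ENNReal.ofReal (√(T N))) atTop (𝓝 0) := by
      have := (ENNReal.continuous_ofReal.comp Real.continuous_sqrt).continuousAt.tendsto.comp hT0
      simpa [Function.comp_def] using this
    have h2 := ENNReal.Tendsto.mul_const (b := μ Set.univ ^ (1 / (1 : ENNReal).toReal - 1 / (2 : ENNReal).toReal)) h1
      (Or.inr (ENNReal.rpow_ne_top_of_nonneg (by norm_num) (measure_ne_top _ _)))
    simpa using h2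
  have hlimint := tendsto_integral_of_L1' (fun p => f p * starRingEnd ℂ (e n p)) (hmulint f hfmem).1
    (F := fun N p => S N p * starRingEnd ℂ (e n p)) (l := atTop)
    (Eventually.of_forall fun N => hmulint (S N) (hSmem N)) hL1
  refine tendsto_nhds_unique hlimint (tendsto_const_nhds.congr' ?_)
  filter_upwards [eventually_gt_atTop n] with N hN
  have h3 : ∀ p, S N p * starRingEnd ℂ (e n p) =
      ∑ k ∈ Finset.range N, (c k : ℂ) * (e k p * starRingEnd ℂ (e n p)) := by
    intro p
    simp only [hS, Finset.sum_mul, Complex.real_smul, mul_assoc]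
  simp_rw [h3]
  rw [integral_finsetSum _ (fun k _ => (hIntg k n).const_mul _)]
  simp_rw [integral_const_mul, horth]
  simp [hN]

lemma weightBeta_meas (β η : ℝ) :
    Measurable (fun p : ℝ × ℝ => weightBeta β η (p.1 ^ 2 + p.2 ^ 2)) := by
  unfold weightBeta
  fun_prop

lemma quat_star_of_sq (I : ℍ[ℝ]) (hI : I ^ 2 = -1) : star I = -I := by
  have h1 := congrArg QuaternionAlgebra.re hI
  have h2 := congrArg QuaternionAlgebra.imI hI
  have h3 := congrArg QuaternionAlgebra.imJ hI
  have h4 := congrArg QuaternionAlgebra.imK hI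
  rw [pow_two] at h1 h2 h3 h4
  simp at h1 h2 h3 h4
  have hre : I.re = 0 := by
    by_contra hne
    have e2 : I.imI = 0 := by
      have : I.re * I.imI = 0 := by linarith
      exact (mul_eq_zero.mp this).resolve_left hne
    have e3 : I.imJ = 0 := by
      have : I.re * I.imJ = 0 := by linarith
      exact (mul_eq_zero.mp this).resolve_left hne
    have e4 : I.imK = 0 := by
      have : I.re * I.imK = 0 := by linarith
      exact (mul_eq_zero.mp this).resolve_left hne
    rw [e2, e3, e4] at h1
    nlinarith [sq_nonneg I.re]
  ext <;> simp [hre]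

lemma disc_series (α β η x y : ℝ) (hα : -1 < α) (hβ : 0 < β) (hη : 0 < η)
    (hx : 0 < x) (hy : 0 < y) (n : ℕ) :
    Integrable (fun p : ℝ × ℝ => weightBeta β η (p.1 ^ 2 + p.2 ^ 2) •
      ((∑' k : ℕ, (lagPhi α k x * lagPhi α k y) •
        (starRingEnd ℂ ((p.1 : ℂ) + p.2 * Complex.I)) ^ k) * ((p.1 : ℂ) + p.2 * Complex.I) ^ n))
      (volume.restrict {p : ℝ × ℝ | p.1 ^ 2 + p.2 ^ 2 < 1}) ∧
    ∫ p in {p : ℝ × ℝ | p.1 ^ 2 + p.2 ^ 2 < 1}, weightBeta β η (p.1 ^ 2 + p.2 ^ 2) •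
      ((∑' k : ℕ, (lagPhi α k x * lagPhi α k y) •
        (starRingEnd ℂ ((p.1 : ℂ) + p.2 * Complex.I)) ^ k) * ((p.1 : ℂ) + p.2 * Complex.I) ^ n)
      = ((lagPhi α n x * lagPhi α n y * (π * gamCoef β η n) : ℝ) : ℂ) := by
  set D : Set (ℝ × ℝ) := {p : ℝ × ℝ | p.1 ^ 2 + p.2 ^ 2 < 1} with hD
  set w : ℝ × ℝ → ℝ := fun p => weightBeta β η (p.1 ^ 2 + p.2 ^ 2) with hw
  set z : ℝ × ℝ → ℂ := fun p => (p.1 : ℂ) + p.2 * Complex.I with hz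
  have hwm : Measurable w := weightBeta_meas β η
  have hDm : MeasurableSet D := disc_meas
  have hzc : Continuous z := by fun_prop
  have hw0 : ∀ p ∈ D, 0 ≤ w p := by
    intro p hp
    have hp' : p.1 ^ 2 + p.2 ^ 2 < 1 := hp
    exact mul_nonneg (Real.rpow_nonneg (by positivity) _) (Real.rpow_nonneg (by linarith) _)
  have hzn : ∀ p ∈ D, ‖z p‖ < 1 := by
    intro p hp
    have hp' : p.1 ^ 2 + p.2 ^ 2 < 1 := hp
    have h : ‖z p‖ ^ 2 = p.1 ^ 2 + p.2 ^ 2 := by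
      rw [← Complex.normSq_eq_norm_sq, hz, Complex.normSq_add_mul_I]
    nlinarith [norm_nonneg (z p)]
  have hwi : Integrable w (volume.restrict D) := by
    have h := disc_moment β η hβ hη 0 0
    have hne : (∫ p in D, w p • ((z p) ^ 0 * (starRingEnd ℂ (z p)) ^ 0)) ≠ 0 := by
      rw [h, if_pos rfl, Complex.ofReal_ne_zero]
      exact (mul_pos Real.pi_pos (gamCoef_pos β η hβ hη 0)).ne'
    have h2 := (Integrable.of_integral_ne_zero hne).re
    refine h2.congr (Filter.Eventually.of_forall fun p => ?_)
    simp
  set ρ : ℝ × ℝ → ENNReal := fun p => ENNReal.ofReal (w p) with hρ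
  set μ : Measure (ℝ × ℝ) := (volume.restrict D).withDensity ρ with hμ
  have : IsFiniteMeasure μ := isFiniteMeasure_withDensity_ofReal hwi.2
  have hρm : Measurable ρ := hwm.ennreal_ofReal
  have hρt : ∀ᵐ p ∂(volume.restrict D), ρ p < ⊤ :=
    Filter.Eventually.of_forall fun p => ENNReal.ofReal_lt_top
  have hsm : ∀ F : ℝ × ℝ → ℂ, (fun p => (ρ p).toReal • F p) =ᵐ[volume.restrict D]
      (fun p => w p • F p) := by
    intro F
    filter_upwards [ae_restrict_mem hDm] with p hp
    rw [hρ]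
    simp only
    rw [ENNReal.toReal_ofReal (hw0 p hp)]
  have hIntg : ∀ F : ℝ × ℝ → ℂ, ∫ p, F p ∂μ = ∫ p in D, w p • F p := by
    intro F
    rw [hμ, integral_withDensity_eq_integral_toReal_smul hρm hρt]
    exact integral_congr_ae (hsm F)
  have hinte : ∀ F : ℝ × ℝ → ℂ, Integrable F μ →
      Integrable (fun p => w p • F p) (volume.restrict D) := by
    intro F hF
    exact ((integrable_withDensity_iff_integrable_smul' hρm hρt).1 hF).congr (hsm F)
  have hae : ∀ᵐ p ∂μ, p ∈ D :=
    (withDensity_absolutelyContinuous _ _).ae_le (ae_restrict_mem hDm)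
  have key := l2_lim μ (fun k p => (starRingEnd ℂ (z p)) ^ k)
    (fun k => ((Complex.continuous_conj.comp hzc).pow k).aestronglyMeasurable)
    (fun k => by
      filter_upwards [hae] with p hp
      rw [norm_pow, RCLike.norm_conj]
      exact pow_le_one₀ (norm_nonneg _) (hzn p hp).le)
    (fun k => π * gamCoef β η k) (fun k => lagPhi α k x * lagPhi α k y)
    (fun k => (mul_pos Real.pi_pos (gamCoef_pos β η hβ hη k)).le)
    (fun m k => by
      rw [hIntg]
      have h := disc_moment β η hβ hη k m
      have h' : ∫ p in D, w p • ((starRingEnd ℂ (z p)) ^ m *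
          starRingEnd ℂ ((starRingEnd ℂ (z p)) ^ k)) =
          ∫ p in D, w p • ((z p) ^ k * (starRingEnd ℂ (z p)) ^ m) := by
        congr 1
        funext p
        rw [map_pow, Complex.conj_conj, mul_comm]
      rw [h']
      refine h.trans ?_
      by_cases hmk : m = k
      · subst hmk
        simp
      · rw [if_neg hmk, if_neg (fun h => hmk h.symm)])
    (((coef_summable α β η x y hα hβ hη hx hy).mul_left π).congr (fun k => by ring))
    (by
      filter_upwards [hae] with p hp
      exact coef_pow_summable α x y hα hx hy _ (by rw [RCLike.norm_conj]; exact hzn p hp))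
    n
  simp only [map_pow, Complex.conj_conj] at key
  refine ⟨hinte _ key.1, ?_⟩
  rw [← hIntg]
  exact key.2

/-- Adjoint identity for `S_y^α` on monomials (Lemma adjointS): the adjoint `(S_y^α)*`
sends `e_n(q) = qⁿ` to `π γ_n^{β,η} φ_n^α(y) φ_n^α`. -/
theorem stmt_14 (α β η x y : ℝ) (hα : -1 < α) (hβ : 0 < β) (hη : 0 < η)
    (hx : 0 < x) (hy : 0 < y) (I : ℍ[ℝ]) (hI : I ^ 2 = -1) (n : ℕ) :
    (∫ p in {p : ℝ × ℝ | p.1 ^ 2 + p.2 ^ 2 < 1},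
      weightBeta β η (p.1 ^ 2 + p.2 ^ 2) •
        (Rker α (star ((p.1 : ℍ[ℝ]) + p.2 • I)) x y * ((p.1 : ℍ[ℝ]) + p.2 • I) ^ n)) =
    ((π * gamCoef β η n * lagPhi α n y * lagPhi α n x : ℝ) : ℍ[ℝ]) := by
  obtain ⟨h1, h2⟩ := disc_series α β η x y hα hβ hη hx hy n
  have hII : I * I = -1 := by rw [← pow_two, hI]
  have hst := quat_star_of_sq I hI
  let J : ℂ →ₐ[ℝ] ℍ[ℝ] := Complex.liftAux I hII
  let JL : ℂ →L[ℝ] ℍ[ℝ] := LinearMap.toContinuousLinearMap J.toLinearMap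
  have hJL : ∀ z, JL z = J z := fun z => rfl
  have hJ : ∀ z : ℂ, J z = ((z.re : ℝ) : ℍ[ℝ]) + z.im • I := fun z =>
    Complex.liftAux_apply I hII z
  have hJz : ∀ p : ℝ × ℝ, J ((p.1 : ℂ) + p.2 * Complex.I) = (p.1 : ℍ[ℝ]) + p.2 • I := by
    intro p
    rw [hJ]
    simp
  have hJs : ∀ p : ℝ × ℝ, J (starRingEnd ℂ ((p.1 : ℂ) + p.2 * Complex.I)) =
      star ((p.1 : ℍ[ℝ]) + p.2 • I) := by
    intro p
    rw [hJ, star_add, Quaternion.star_smul, hst]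
    simp
  have h3 := JL.integral_comp_comm h1
  rw [h2] at h3
  have h4 : JL ((lagPhi α n x * lagPhi α n y * (π * gamCoef β η n) : ℝ) : ℂ) =
      ((π * gamCoef β η n * lagPhi α n y * lagPhi α n x : ℝ) : ℍ[ℝ]) := by
    rw [hJL, hJ, Complex.ofReal_re, Complex.ofReal_im, zero_smul, add_zero]
    congr 1
    ring
  rw [← h4, ← h3]
  refine setIntegral_congr_fun disc_meas fun p hp => ?_
  have hp' : p.1 ^ 2 + p.2 ^ 2 < 1 := hp
  have hzn : ‖starRingEnd ℂ ((p.1 : ℂ) + p.2 * Complex.I)‖ < 1 := by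
    rw [RCLike.norm_conj]
    have h : ‖(p.1 : ℂ) + p.2 * Complex.I‖ ^ 2 = p.1 ^ 2 + p.2 ^ 2 := by
      rw [← Complex.normSq_eq_norm_sq, Complex.normSq_add_mul_I]
    nlinarith [norm_nonneg ((p.1 : ℂ) + p.2 * Complex.I)]
  have hs := coef_pow_summable α x y hα hx hy _ hzn
  have hR : Rker α (star ((p.1 : ℍ[ℝ]) + p.2 • I)) x y =
      JL (∑' k : ℕ, (lagPhi α k x * lagPhi α k y) •
        (starRingEnd ℂ ((p.1 : ℂ) + p.2 * Complex.I)) ^ k) := by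
    rw [JL.map_tsum hs]
    unfold Rker
    refine tsum_congr fun k => ?_
    rw [JL.map_smul, hJL, map_pow, hJs]
  rw [JL.map_smul, hR, hJL, hJL, map_mul, map_pow, hJz]
end

section
/- Vanishing of the singular values (compactness of S_y^α, Proposition corcomp): for every real α > -1, all β, η > 0, and every y > 0, the sequence n ↦ π γ_n^{β,η} φ_n^α(y)² tends to 0 as n → ∞; consequently the operator S_y^α : L^{2,α}(ℝ_+; ℍ) → A^{2,β,η}_slice is compact. -/
open MeasureTheory Real Filter

theorem genLaguerre_eq (α y : ℝ) (n : ℕ) :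
    genLaguerre α n y = Real.Gamma (n + α + 1) / (Nat.factorial n) *
      ∑ k ∈ Finset.range (n + 1), (n.choose k : ℝ) * ((-y) ^ k / Real.Gamma (k + α + 1)) := by
  unfold genLaguerre
  rw [Finset.mul_sum]
  refine Finset.sum_congr rfl fun k hk => ?_
  have hk' : k ≤ n := by simpa [Nat.lt_succ_iff] using hk
  rw [Nat.cast_choose ℝ hk', neg_pow y k]
  have h1 : (Nat.factorial n : ℝ) ≠ 0 := by positivity
  have h2 : (Nat.factorial k : ℝ) ≠ 0 := by positivity
  have h3 : (Nat.factorial (n - k) : ℝ) ≠ 0 := by positivity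
  field_simp

theorem lagP_rec (α y : ℝ) (hα : -1 < α) (P : ℕ → ℝ)
    (hP : ∀ n, P n = ∑ k ∈ Finset.range (n + 1),
      (n.choose k : ℝ) * ((-y) ^ k / Real.Gamma (k + α + 1))) (n : ℕ) :
    (n + α + 2) * P (n + 2) = (2 * n + 3 + α - y) * P (n + 1) - (n + 1) * P n := by
  set a : ℕ → ℝ := fun k => (-y) ^ k / Real.Gamma (k + α + 1) with ha
  have hstep : ∀ k : ℕ, -y * a k = (k + 1 + α) * a (k + 1) := by
    intro k
    have hpos : (0 : ℝ) < k + α + 1 := by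
      have : (0 : ℝ) ≤ k := by positivity
      linarith
    have hg : Real.Gamma ((k + 1 : ℕ) + α + 1) = (k + α + 1) * Real.Gamma (k + α + 1) := by
      rw [← Real.Gamma_add_one hpos.ne']
      congr 1
      push_cast
      ring
    have := (Real.Gamma_pos_of_pos hpos).ne'
    simp only [ha]
    rw [hg]
    field_simp
    ring
  have e2 : P (n + 2) = ∑ k ∈ Finset.range (n + 2), ((n + 2).choose (k + 1) : ℝ) * a (k + 1) + a 0 := by
    rw [hP, Finset.sum_range_succ']
    simp [ha]
  have e1 : P (n + 1) = ∑ k ∈ Finset.range (n + 2), ((n + 1).choose (k + 1) : ℝ) * a (k + 1) + a 0 := by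
    rw [hP, Finset.sum_range_succ', Finset.sum_range_succ _ (n + 1)]
    simp [ha]
  have e0 : P n = ∑ k ∈ Finset.range (n + 2), (n.choose (k + 1) : ℝ) * a (k + 1) + a 0 := by
    rw [hP, Finset.sum_range_succ', Finset.sum_range_succ _ (n + 1), Finset.sum_range_succ _ n,
      Nat.choose_eq_zero_of_lt (show n < n + 1 + 1 by omega)]
    simp [ha]
  have ey : -y * P (n + 1) = ∑ k ∈ Finset.range (n + 2),
      ((n + 1).choose k : ℝ) * ((k + 1 + α) * a (k + 1)) := by
    rw [hP, Finset.mul_sum]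
    refine Finset.sum_congr rfl fun k _ => ?_
    rw [← hstep]
    simp only [ha]
    ring
  have key : (n + α + 2) * ∑ k ∈ Finset.range (n + 2), ((n + 2).choose (k + 1) : ℝ) * a (k + 1)
      = (2 * n + 3 + α) * ∑ k ∈ Finset.range (n + 2), ((n + 1).choose (k + 1) : ℝ) * a (k + 1)
        + ∑ k ∈ Finset.range (n + 2), ((n + 1).choose k : ℝ) * ((k + 1 + α) * a (k + 1))
        - (n + 1) * ∑ k ∈ Finset.range (n + 2), (n.choose (k + 1) : ℝ) * a (k + 1) := by
    rw [Finset.mul_sum, Finset.mul_sum, Finset.mul_sum, ← Finset.sum_add_distrib,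
      ← Finset.sum_sub_distrib]
    refine Finset.sum_congr rfl fun k _ => ?_
    have c1 : ((n + 2).choose (k + 1) : ℝ) = (n + 1).choose k + (n + 1).choose (k + 1) := by
      exact_mod_cast Nat.choose_succ_succ (n + 1) k
    have c2 : ((n + 1).choose (k + 1) : ℝ) = n.choose k + n.choose (k + 1) := by
      exact_mod_cast Nat.choose_succ_succ n k
    have c3 : ((n : ℝ) + 1) * n.choose k = (n + 1).choose (k + 1) * (k + 1) := by
      exact_mod_cast Nat.add_one_mul_choose_eq n k
    have c4 : ((n : ℝ) + 2) * (n + 1).choose k = (n + 2).choose (k + 1) * (k + 1) := by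
      exact_mod_cast Nat.add_one_mul_choose_eq (n + 1) k
    have c5 : ((n : ℝ) + α + 2) * (n + 2).choose (k + 1) =
        (2 * n + 3 + α) * (n + 1).choose (k + 1) + (n + 1).choose k * (k + 1 + α)
          - (n + 1) * n.choose (k + 1) := by
      rw [c1] at c4 ⊢
      linear_combination c4 - c3 - (n + 1 : ℝ) * c2
    linear_combination a (k + 1) * c5
  rw [e2, e0]
  have : (2 * n + 3 + α - y) * P (n + 1) = (2 * n + 3 + α) * P (n + 1) + (-y * P (n + 1)) := by ring
  rw [this, ey, e1]
  linear_combination key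

theorem quad_nonneg {A B C : ℝ} (hA : 0 < A) (h : B ^ 2 ≤ 4 * A * C) (d l : ℝ) :
    0 ≤ A * d ^ 2 + B * (l * d) + C * l ^ 2 := by
  have h1 : 0 ≤ 4 * A * (A * d ^ 2 + B * (l * d) + C * l ^ 2) := by
    nlinarith [sq_nonneg (2 * A * d + B * l), mul_nonneg (sub_nonneg.2 h) (sq_nonneg l)]
  exact nonneg_of_mul_nonneg_right h1 (by positivity)

/-- One step of the discrete energy estimate. -/
theorem energy_step (α y : ℝ) (hy : 0 < y) :
    ∀ᶠ N : ℝ in atTop, ∀ l d d' : ℝ, (N + 1) * d' = (N + α) * d - y * l →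
      (N + 1) * ((N + 1) * d' ^ 2 + y * (l + d') ^ 2 + (1 / 2 - α - y) * ((l + d') * d'))
        ≤ (N + α + 1) * (N * d ^ 2 + y * l ^ 2 + (1 / 2 - α - y) * (l * d)) := by
  have t0 : Tendsto (fun N : ℝ => (N + 1)⁻¹) atTop (nhds 0) :=
    tendsto_inv_atTop_zero.comp (tendsto_atTop_add_const_right _ _ tendsto_id)
  set b : ℝ := 1 / 2 - α with hb
  have tC : Tendsto (fun N : ℝ => y / 2 - y ^ 2 * (b * (N + 1)⁻¹)) atTop
      (nhds (y / 2 - y ^ 2 * (b * 0))) :=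
    tendsto_const_nhds.sub (tendsto_const_nhds.mul (tendsto_const_nhds.mul t0))
  have tB : Tendsto (fun N : ℝ => (1 / 2 - α - y) + 2 * y * b * (1 + (α - 1) * (N + 1)⁻¹)) atTop
      (nhds ((1 / 2 - α - y) + 2 * y * b * (1 + (α - 1) * 0))) :=
    tendsto_const_nhds.add (tendsto_const_nhds.mul (tendsto_const_nhds.add (tendsto_const_nhds.mul t0)))
  set B0 : ℝ := (1 / 2 - α - y) + 2 * y * b * (1 + (α - 1) * 0) with hB0
  have tB2 := tB.pow 2
  have eC := tC.eventually (lt_mem_nhds (show y / 4 < y / 2 - y ^ 2 * (b * 0) by linarith))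
  have eB := tB2.eventually (gt_mem_nhds (show B0 ^ 2 < B0 ^ 2 + 1 by linarith))
  -- d² coefficient
  have tA' : Tendsto (fun N : ℝ => b * (α - 1) ^ 2 * (N + 1)⁻¹) atTop
      (nhds (b * (α - 1) ^ 2 * 0)) := tendsto_const_nhds.mul t0
  have eA := tA'.eventually (gt_mem_nhds (show b * (α - 1) ^ 2 * 0 < 1 by norm_num))
  filter_upwards [eC, eB, eA, eventually_gt_atTop 0,
    eventually_ge_atTop (4 * (α ^ 2 + |b| * (1 + 2 * |α - 1|) + 1)),
    eventually_ge_atTop (4 * (B0 ^ 2 + 1) / y)] with N hC hB hA hN hN1 hN2 l d d' hd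
  set r := (N + 1)⁻¹ with hr
  have hr1 : (N + 1) * r = 1 := mul_inv_cancel₀ (by linarith)
  have hd' : d' = r * ((N + α) * d - y * l) := by
    rw [← hd]; linear_combination -d' * hr1
  set A' := (N + α + 1) * N - (N + α) ^ 2 * (1 + b * r) with hA'
  set B' := (1 / 2 - α - y) + 2 * y * b * (1 + (α - 1) * r) with hB'
  set C' := y / 2 - y ^ 2 * (b * r) with hC'
  have hA4 : N / 4 ≤ A' := by
    have : A' = N / 2 - α ^ 2 - b * (1 + 2 * (α - 1)) - b * (α - 1) ^ 2 * r := by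
      rw [hA', hb]
      linear_combination (-(1/2 - α) * (N + 1 + 2 * (α - 1))) * hr1
    have h2 : b * (1 + 2 * (α - 1)) ≤ |b| * (1 + 2 * |α - 1|) := by
      calc b * (1 + 2 * (α - 1)) ≤ |b * (1 + 2 * (α - 1))| := le_abs_self _
        _ = |b| * |1 + 2 * (α - 1)| := abs_mul _ _
        _ ≤ _ := by
          gcongr
          calc |1 + 2 * (α - 1)| ≤ |1| + |2 * (α - 1)| := abs_add_le _ _
            _ = _ := by rw [abs_mul]; norm_num
    rw [this]
    linarith
  have hq := quad_nonneg (A := A') (B := B') (C := C') (by linarith) (by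
    rw [div_le_iff₀ hy] at hN2
    have hA0 : 0 ≤ A' := by linarith
    have : N / 4 * (y / 4) ≤ A' * C' := by gcongr
    nlinarith) d l
  have hiden : (N + α + 1) * (N * d ^ 2 + y * l ^ 2 + (1 / 2 - α - y) * (l * d))
      - (N + 1) * ((N + 1) * d' ^ 2 + y * (l + d') ^ 2 + (1 / 2 - α - y) * ((l + d') * d'))
      = A' * d ^ 2 + B' * (l * d) + C' * l ^ 2 := by
    have h1 : (N + 1) * ((N + 1) * d' ^ 2 + y * (l + d') ^ 2 + (1 / 2 - α - y) * ((l + d') * d'))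
      = ((N + 1) * d') ^ 2 + y * (N + 1) * l ^ 2 + (2 * y + (1 / 2 - α - y)) * l * ((N + 1) * d')
        + b * ((N + 1) * d') * d' := by rw [hb]; ring
    rw [h1, hd, hd', hA', hB', hC', hb]
    linear_combination (2 * y * (1/2 - α) * l * d) * hr1
  rw [hb]
  linarith

theorem gamCoef_tendsto (β η : ℝ) (hβ : 0 < β) (hη : 0 < η) :
    Tendsto (gamCoef β η) atTop (nhds 0) := by
  have prodG : ∀ s : ℝ, 0 < s → ∀ n : ℕ,
      Real.Gamma (s + (n + 1 : ℕ)) = Real.Gamma s * ∏ j ∈ Finset.range (n + 1), (s + j) := by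
    intro s hs n
    induction n with
    | zero => simp [Real.Gamma_add_one hs.ne']; ring
    | succ n ih =>
      rw [Finset.prod_range_succ, ← mul_assoc, ← ih]
      have : s + ((n + 1 + 1 : ℕ) : ℝ) = (s + (n + 1 : ℕ)) + 1 := by push_cast; ring
      rw [this, Real.Gamma_add_one (by positivity)]; ring
  rw [← tendsto_add_atTop_iff_nat 1]
  have h1 := Real.GammaSeq_tendsto_Gamma β
  have h2 := Real.GammaSeq_tendsto_Gamma (β + η)
  have h3 : Tendsto (fun n : ℕ => (n : ℝ) ^ (-η)) atTop (nhds 0) :=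
    (tendsto_rpow_neg_atTop hη).comp tendsto_natCast_atTop_atTop
  have h4 := ((h2.div h1 (Real.Gamma_pos_of_pos hβ).ne').mul h3).const_mul
    (Real.Gamma η * (Real.Gamma β / Real.Gamma (β + η)))
  rw [mul_zero, mul_zero] at h4
  refine h4.congr' ?_
  filter_upwards [eventually_gt_atTop 0] with n hn
  have hn' : (0 : ℝ) < n := by exact_mod_cast hn
  unfold gamCoef
  rw [prodG β hβ n, prodG (β + η) (by positivity) n]
  simp only [Real.GammaSeq, Pi.div_apply]
  rw [Real.rpow_add hn', Real.rpow_neg hn'.le]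
  have p1 : (0 : ℝ) < ∏ j ∈ Finset.range (n + 1), (β + j) :=
    Finset.prod_pos fun j _ => by positivity
  have p2 : (0 : ℝ) < ∏ j ∈ Finset.range (n + 1), (β + η + j) :=
    Finset.prod_pos fun j _ => by positivity
  have p3 := Real.rpow_pos_of_pos hn' β
  have p4 := Real.rpow_pos_of_pos hn' η
  have p5 := Real.Gamma_pos_of_pos hβ
  have p6 := Real.Gamma_pos_of_pos (show 0 < β + η by positivity)
  have p7 : (0 : ℝ) < Nat.factorial n := by positivity
  field_simp

theorem lagPhi_bounded (α y : ℝ) (hα : -1 < α) (hy : 0 < y) :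
    ∃ M : ℝ, ∀ᶠ n : ℕ in atTop, (lagPhi α n y) ^ 2 ≤ M := by
  set w : ℕ → ℝ := fun n => (Nat.factorial n : ℝ) / Real.Gamma (n + α + 1) with hw
  set L : ℕ → ℝ := fun n => genLaguerre α n y with hL
  have npos : ∀ n : ℕ, (0 : ℝ) < n + α + 1 := fun n => by
    have : (0 : ℝ) ≤ n := by positivity
    linarith
  have wpos : ∀ n, 0 < w n := fun n =>
    div_pos (by positivity) (Real.Gamma_pos_of_pos (npos n))
  have wrec : ∀ n : ℕ, (n + α + 1) * w (n + 1) = (n + 1) * w n := by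
    intro n
    have hg : Real.Gamma ((n + 1 : ℕ) + α + 1) = (n + α + 1) * Real.Gamma (n + α + 1) := by
      rw [← Real.Gamma_add_one (npos n).ne']
      congr 1
      push_cast
      ring
    have h1 := (Real.Gamma_pos_of_pos (npos n)).ne'
    have h2 := (npos n).ne'
    simp only [hw]
    rw [hg, Nat.factorial_succ]
    push_cast
    field_simp
  have hphi : ∀ n, (lagPhi α n y) ^ 2 = w n * L n ^ 2 := fun n => by
    unfold lagPhi
    rw [mul_pow, Real.sq_sqrt (wpos n).le]
  have hLP : ∀ n, w n * L n = ∑ k ∈ Finset.range (n + 1),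
      (n.choose k : ℝ) * ((-y) ^ k / Real.Gamma (k + α + 1)) := fun n => by
    simp only [hL, hw]
    rw [genLaguerre_eq, ← mul_assoc]
    have h1 := (Real.Gamma_pos_of_pos (npos n)).ne'
    have h2 : (Nat.factorial n : ℝ) ≠ 0 := by positivity
    rw [div_mul_div_comm, mul_comm (Nat.factorial n : ℝ), div_self (mul_ne_zero h1 h2), one_mul]
  have hrec : ∀ n : ℕ, ((n : ℝ) + 2) * L (n + 2) =
      (2 * n + 3 + α - y) * L (n + 1) - (n + 1 + α) * L n := by
    intro n
    have h := lagP_rec α y hα (fun n => w n * L n) hLP n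
    have w1 := wrec n
    have w2 := wrec (n + 1)
    push_cast at w2
    refine mul_left_cancel₀ (wpos (n + 1)).ne' ?_
    linear_combination h - L (n + 2) * w2 + L n * w1
  set F : ℕ → ℝ := fun n => ((n : ℝ) + 1) * (L (n + 1) - L n) ^ 2 + y * L (n + 1) ^ 2
    + (1 / 2 - α - y) * (L (n + 1) * (L (n + 1) - L n)) with hF
  have tN : Tendsto (fun n : ℕ => (n : ℝ) + 1) atTop atTop :=
    tendsto_atTop_add_const_right _ _ tendsto_natCast_atTop_atTop
  obtain ⟨n0, hn0⟩ := eventually_atTop.1 (tN.eventually (energy_step α y hy))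
  have hmono : ∀ n, n0 ≤ n → w (n + 2) * F (n + 1) ≤ w (n + 1) * F n := by
    intro n hn
    have h := hn0 n hn (L (n + 1)) (L (n + 1) - L n) (L (n + 2) - L (n + 1)) (by
      linear_combination hrec n)
    have w2 := wrec (n + 1)
    push_cast at w2
    have hp := npos (n + 1)
    push_cast at hp
    have e : ((n : ℝ) + 1 + 1) * F (n + 1) ≤ (n + 1 + α + 1) * F n := by
      simp only [hF]
      push_cast
      calc _ = _ := by ring
        _ ≤ _ := h
    have e2 := mul_le_mul_of_nonneg_left e (wpos (n + 1)).le
    refine le_of_mul_le_mul_left ?_ hp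
    calc _ = w (n + 1) * ((n + 1 + 1) * F (n + 1)) := by linear_combination F (n + 1) * w2
      _ ≤ _ := e2
      _ = _ := by ring
  have hbd : ∀ n, n0 ≤ n → w (n + 1) * F n ≤ w (n0 + 1) * F n0 := by
    intro n hn
    induction n, hn using Nat.le_induction with
    | base => exact le_rfl
    | succ n hn ih => exact (hmono n hn).trans ih
  refine ⟨2 / y * (w (n0 + 1) * F n0), ?_⟩
  obtain ⟨n1, hn1⟩ := eventually_atTop.1
    (tN.eventually (eventually_ge_atTop ((1 / 2 - α - y) ^ 2 / (2 * y))))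
  filter_upwards [eventually_ge_atTop (n0 + n1 + 1)] with m hm
  obtain ⟨n, rfl⟩ : ∃ n, m = n + 1 := ⟨m - 1, by omega⟩
  rw [hphi]
  have h1 := hn1 n (by omega)
  rw [div_le_iff₀ (by positivity)] at h1
  have hq := quad_nonneg (A := (n : ℝ) + 1) (B := 1 / 2 - α - y) (C := y / 2) (by positivity)
    (by linarith) (L (n + 1) - L n) (L (n + 1))
  have hFL : y / 2 * L (n + 1) ^ 2 ≤ F n := by
    simp only [hF]
    linarith
  calc w (n + 1) * L (n + 1) ^ 2 = 2 / y * (w (n + 1) * (y / 2 * L (n + 1) ^ 2)) := by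
        field_simp
    _ ≤ 2 / y * (w (n + 1) * F n) := by
        have := (wpos (n + 1)).le
        gcongr
    _ ≤ _ := by
        have := hbd n (by omega)
        gcongr

/-- Vanishing of the squared singular values of `S_y^α` (Proposition corcomp):
the sequence `n ↦ π γ_n^{β,η} φ_n^α(y)²` tends to `0`; consequently `S_y^α` is
a compact operator. -/
theorem stmt_15 (α β η y : ℝ) (hα : -1 < α) (hβ : 0 < β) (hη : 0 < η) (hy : 0 < y) :
    Tendsto (fun n : ℕ => π * gamCoef β η n * (lagPhi α n y) ^ 2) atTop (nhds 0) := by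
  obtain ⟨M, hM⟩ := lagPhi_bounded α y hα hy
  have h0 := ((gamCoef_tendsto β η hβ hη).const_mul π).mul_const M
  rw [mul_zero, zero_mul] at h0
  have hg : ∀ n : ℕ, 0 ≤ π * gamCoef β η n := fun n => by
    have h1 := Real.Gamma_pos_of_pos hη
    have h2 := Real.Gamma_pos_of_pos (show 0 < β + n by positivity)
    have h3 := Real.Gamma_pos_of_pos (show 0 < β + η + n by positivity)
    unfold gamCoef
    positivity
  refine tendsto_of_tendsto_of_tendsto_of_le_of_le' tendsto_const_nhds h0
    (Eventually.of_forall fun n => mul_nonneg (hg n) (sq_nonneg _)) ?_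
  filter_upwards [hM] with n hn
  exact mul_le_mul_of_nonneg_left hn (hg n)
end

section
/- Key decay bound (estimate (17)): let α > -1, β, η > 0, and y > 0. Then there exist a constant M > 0 and an index N ∈ ℕ such that for every n ≥ N, π γ_n^{β,η} φ_n^α(y)² ≤ M · n^{-(η + 1/2)}; that is, the sequence c_n^{α,β,η}(y) = π γ_n^{β,η} φ_n^α(y)² is O(n^{-η-1/2}) as n → ∞. -/
open MeasureTheory Real

open Filter Topology

lemma gamma_asymp (s : ℝ) (hs : 0 < s) :
    Tendsto (fun n : ℕ => Real.Gamma (s + n) / (n.factorial * (n : ℝ) ^ (s - 1))) atTop (𝓝 1) := by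
  have h1 := Real.GammaSeq_tendsto_Gamma s
  have hG : Real.Gamma s ≠ 0 := (Real.Gamma_pos_of_pos hs).ne'
  have hprod : ∀ n : ℕ, Real.Gamma (s + n) * (s + n) =
      Real.Gamma s * ∏ j ∈ Finset.range (n + 1), (s + j) := by
    intro n
    induction n with
    | zero => simp
    | succ k ih =>
      rw [Finset.prod_range_succ, ← mul_assoc, ← ih]
      push_cast
      rw [show s + ((k : ℝ) + 1) = (s + k) + 1 by ring,
        Real.Gamma_add_one (by positivity)]
      ring
  have h2 : Tendsto (fun n : ℕ => Real.Gamma s / Real.GammaSeq s n * ((n : ℝ) / (n + s))) atTop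
      (𝓝 (Real.Gamma s / Real.Gamma s * 1)) := by
    refine (tendsto_const_nhds.div h1 hG).mul ?_
    exact tendsto_natCast_div_add_atTop s
  rw [div_self hG, one_mul] at h2
  refine h2.congr' ?_
  filter_upwards [eventually_gt_atTop 0] with n hn
  have hn' : (0 : ℝ) < n := by exact_mod_cast hn
  have hP : 0 < ∏ j ∈ Finset.range (n + 1), (s + j) :=
    Finset.prod_pos (fun j _ => by positivity)
  have h3 : Real.Gamma (s + n) = Real.Gamma s * (∏ j ∈ Finset.range (n + 1), (s + j)) / (s + n) := by
    rw [← hprod n]; field_simp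
  rw [h3, Real.GammaSeq, Real.rpow_sub_one hn'.ne']
  have : (0:ℝ) < (n : ℝ) ^ s := by positivity
  have : (n : ℝ) + s ≠ 0 := by positivity
  have : s + (n : ℝ) ≠ 0 := by positivity
  field_simp
  try ring

lemma gamma_bounds (s : ℝ) (hs : 0 < s) : ∀ᶠ n : ℕ in atTop,
    Real.Gamma (s + n) ≤ 2 * (n.factorial * (n : ℝ) ^ (s - 1)) ∧
    (n.factorial * (n : ℝ) ^ (s - 1)) ≤ 2 * Real.Gamma (s + n) := by
  have h := gamma_asymp s hs
  filter_upwards [h.eventually (gt_mem_nhds (show (1:ℝ) < 2 by norm_num)),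
    h.eventually (lt_mem_nhds (show (1/2:ℝ) < 1 by norm_num)), eventually_gt_atTop 0] with n h1 h2 hn
  have hn' : (0 : ℝ) < n := by exact_mod_cast hn
  have hp : (0:ℝ) < n.factorial * (n : ℝ) ^ (s - 1) := by positivity
  rw [div_lt_iff₀ hp] at h1
  rw [lt_div_iff₀ hp] at h2
  constructor <;> linarith

/-- Energy estimate. -/
lemma energy_bound (α n : ℝ) (hn : 1 ≤ n) (f f1 f2 : ℝ → ℝ)
    (hf : ∀ x, HasDerivAt f (f1 x) x) (hf1 : ∀ x, HasDerivAt f1 (f2 x) x)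
    (ode : ∀ x, x * f2 x + (α + 1 - x) * f1 x + n * f x = 0)
    (a b : ℝ) (ha : 0 < a) (hab : a ≤ b) (E : ℝ → ℝ)
    (hE : E = fun x => (x ^ (α + 1/2) * exp (-x^2/2) *
        (((α + 1/2) / x - x) * f (x^2) + 2 * x * f1 (x^2)))^2
        + 4 * n * (x ^ (α + 1/2) * exp (-x^2/2) * f (x^2))^2) :
    E b ≤ E a * exp ((|2 * α + 2| + b^2) * b + |α^2 - 1/4| / (a * √n)) := by
  set m : ℝ := √n with hm
  have hm1 : 1 ≤ m := by rw [hm]; exact Real.one_le_sqrt.2 hn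
  have hmm : m ^ 2 = n := Real.sq_sqrt (by linarith)
  set A := |2 * α + 2| + b^2 with hA
  set B := |α^2 - 1/4| with hB
  have hA0 : 0 ≤ A := by positivity
  have hB0 : 0 ≤ B := by positivity
  set u : ℝ → ℝ := fun x => x ^ (α + 1/2) * exp (-x^2/2) * f (x^2) with hu
  set u1 : ℝ → ℝ := fun x => x ^ (α + 1/2) * exp (-x^2/2) *
        (((α + 1/2) / x - x) * f (x^2) + 2 * x * f1 (x^2)) with hu1
  have hEu : ∀ x, E x = (u1 x)^2 + 4 * n * (u x)^2 := by intro x; rw [hE]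
  have hw : ∀ x : ℝ, 0 < x → HasDerivAt (fun x : ℝ => x ^ (α + 1/2) * exp (-x^2/2))
      (x ^ (α + 1/2) * exp (-x^2/2) * ((α + 1/2) / x - x)) x := by
    intro x hx
    have e1 := Real.hasDerivAt_rpow_const (x := x) (p := α + 1/2) (Or.inl hx.ne')
    have e2 : HasDerivAt (fun x : ℝ => exp (-x^2/2)) (exp (-x^2/2) * (-x)) x := by
      have : HasDerivAt (fun x : ℝ => -x^2/2) (-x) x := by
        have := ((hasDerivAt_pow 2 x).neg.div_const 2)
        refine this.congr_deriv ?_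
        simp only [Nat.cast_ofNat]
        ring
      exact this.exp
    refine (e1.mul e2).congr_deriv ?_
    rw [Real.rpow_sub_one hx.ne']
    ring
  have hF : ∀ x : ℝ, HasDerivAt (fun x => f (x^2)) (2 * x * f1 (x^2)) x := by
    intro x
    have := (hf (x^2)).comp x (hasDerivAt_pow 2 x)
    refine this.congr_deriv ?_
    simp; ring
  have hF1 : ∀ x : ℝ, HasDerivAt (fun x => f1 (x^2)) (2 * x * f2 (x^2)) x := by
    intro x
    have := (hf1 (x^2)).comp x (hasDerivAt_pow 2 x)
    refine this.congr_deriv ?_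
    simp; ring
  have hud : ∀ x, 0 < x → HasDerivAt u (u1 x) x := by
    intro x hx
    refine ((hw x hx).mul (hF x)).congr_deriv ?_
    simp only [hu1]; ring
  have hu1d : ∀ x, 0 < x → HasDerivAt u1
      (((α^2 - 1/4) / x^2 - (2 * α + 2) + x^2 - 4 * n) * u x) x := by
    intro x hx
    have p1 : HasDerivAt (fun x : ℝ => (α + 1/2) / x - x) (-(α + 1/2) / x^2 - 1) x := by
      have := ((hasDerivAt_inv hx.ne').const_mul (α + 1/2)).sub (hasDerivAt_id x)
      refine this.congr_deriv ?_
      field_simp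
    have p2 : HasDerivAt (fun x : ℝ => 2 * x) 2 x := by
      simpa using (hasDerivAt_id x).const_mul (2:ℝ)
    have := (hw x hx).mul ((p1.mul (hF x)).add (p2.mul (hF1 x)))
    refine this.congr_deriv ?_
    simp only [hu, Pi.add_apply, Pi.mul_apply]
    have o := ode (x^2)
    field_simp
    linear_combination (64 * x^2 : ℝ) * o
  have hGd : ∀ x, 0 < x → HasDerivAt (fun x : ℝ => (A * x - B * x⁻¹) / m) ((A + B / x^2) / m) x := by
    intro x hx
    have := (((hasDerivAt_id x).const_mul A).sub ((hasDerivAt_inv hx.ne').const_mul B)).div_const m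
    refine this.congr_deriv ?_
    field_simp
    try ring
  have hanti : AntitoneOn (fun x => E x * exp (-((A * x - B * x⁻¹) / m))) (Set.Icc a b) := by
    have hd : ∀ x, 0 < x → HasDerivAt (fun x => E x * exp (-((A * x - B * x⁻¹) / m)))
       ((2 * u1 x * (((α^2 - 1/4) / x^2 - (2 * α + 2) + x^2 - 4 * n) * u x) + 4 * n * (2 * u x * u1 x))
         * exp (-((A * x - B * x⁻¹) / m)) + E x * (exp (-((A * x - B * x⁻¹) / m)) *
          (-((A + B / x^2) / m)))) x := by
      intro x hx
      have e : HasDerivAt E (2 * u1 x * (((α^2 - 1/4) / x^2 - (2 * α + 2) + x^2 - 4 * n) * u x) + 4 * n * (2 * u x * u1 x)) x := by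
        have hE' : E = fun x => (u1 x)^2 + 4 * n * (u x)^2 := funext hEu
        rw [hE']
        have := ((hu1d x hx).pow 2).add (((hud x hx).pow 2).const_mul (4 * n))
        refine this.congr_deriv ?_
        simp
      exact e.mul (hGd x hx).neg.exp
    refine antitoneOn_of_deriv_nonpos (convex_Icc a b) ?_ ?_ ?_
    · intro x hx
      exact (hd x (lt_of_lt_of_le ha hx.1)).continuousAt.continuousWithinAt
    · intro x hx
      rw [interior_Icc] at hx
      exact (hd x (ha.trans hx.1)).differentiableAt.differentiableWithinAt
    · intro x hx
      rw [interior_Icc] at hx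
      have hx0 : 0 < x := ha.trans hx.1
      rw [(hd x hx0).deriv]
      have hq : |(α^2 - 1/4) / x^2 - (2 * α + 2) + x^2| ≤ A + B / x^2 := by
        have h1 : |(α^2 - 1/4) / x^2| = B / x^2 := by
          rw [abs_div, abs_of_pos (by positivity : 0 < x^2)]
        have h2 : |x^2| ≤ b^2 := by
          rw [abs_of_pos (by positivity : 0 < x^2)]
          exact pow_le_pow_left₀ hx0.le hx.2.le 2
        calc _ ≤ |(α^2 - 1/4) / x^2| + |2 * α + 2| + |x^2| :=
              (abs_add_le _ _).trans (add_le_add_left (abs_sub _ _) _)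
          _ ≤ _ := by rw [h1, hA]; linarith
      have huu : |2 * u1 x * u x| ≤ E x / m := by
        rw [hEu, le_div_iff₀ (by linarith), ← hmm, ← abs_of_pos (by linarith : 0 < m), ← abs_mul,
          abs_of_pos (by linarith : 0 < m), abs_le]
        constructor <;> nlinarith [sq_nonneg (u1 x + m * u x), sq_nonneg (u1 x - m * u x),
          sq_nonneg (m * u x)]
      have hEx : 0 ≤ E x := by rw [hEu]; positivity
      have key : 2 * u1 x * u x * ((α^2 - 1/4) / x^2 - (2 * α + 2) + x^2) ≤ E x / m * (A + B / x^2) := by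
        refine (le_abs_self _).trans ?_
        rw [abs_mul]
        exact mul_le_mul huu hq (abs_nonneg _) (by positivity)
      have hexp := exp_pos (-((A * x - B * x⁻¹) / m))
      have : (2 * u1 x * u x * ((α^2 - 1/4) / x^2 - (2 * α + 2) + x^2) - E x / m * (A + B / x^2))
          * exp (-((A * x - B * x⁻¹) / m)) ≤ 0 :=
        mul_nonpos_of_nonpos_of_nonneg (by linarith) hexp.le
      refine le_of_eq_of_le ?_ this
      ring
  have h := hanti (Set.left_mem_Icc.2 hab) (Set.right_mem_Icc.2 hab) hab
  simp only at h
  have hb : 0 < b := lt_of_lt_of_le ha hab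
  have hEa : 0 ≤ E a := by rw [hEu]; positivity
  have h2 : E b ≤ E a * exp (((A * b - B * b⁻¹) / m) - ((A * a - B * a⁻¹) / m)) := by
    rw [sub_eq_add_neg, exp_add, mul_comm (exp _), ← mul_assoc]
    calc E b = E b * exp (-((A * b - B * b⁻¹) / m)) * exp ((A * b - B * b⁻¹) / m) := by
            rw [mul_assoc, ← exp_add]; simp
      _ ≤ _ := mul_le_mul_of_nonneg_right h (exp_pos _).le
  refine h2.trans (mul_le_mul_of_nonneg_left (exp_le_exp.2 ?_) hEa)
  have i1 : A * b / m ≤ A * b := div_le_self (by positivity) hm1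
  have i2 : 0 ≤ B * b⁻¹ / m := by positivity
  have i3 : 0 ≤ A * a / m := by positivity
  have i4 : B * a⁻¹ / m = B / (a * m) := by field_simp
  rw [sub_div, sub_div, i4]
  linarith

noncomputable def lagC (α : ℝ) (n k : ℕ) : ℝ :=
  if k ≤ n then ((-1 : ℝ) ^ k / (Nat.factorial k)) *
      (Real.Gamma (n + α + 1) / (Real.Gamma (k + α + 1) * (Nat.factorial (n - k)))) else 0

lemma lagC_rec (α : ℝ) (hα : -1 < α) (n k : ℕ) :
    ((k:ℝ) + 1) * (k + α + 1) * lagC α n (k+1) = -((n:ℝ) - k) * lagC α n k := by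
  unfold lagC
  rcases lt_trichotomy k n with h | h | h
  · rw [if_pos (by omega), if_pos (by omega)]
    obtain ⟨d, rfl⟩ := Nat.exists_eq_add_of_lt h
    rw [show k + d + 1 - (k+1) = d by omega, show k + d + 1 - k = d + 1 by omega]
    have hk : 0 < (k:ℝ) + α + 1 := by have : (0:ℝ) ≤ k := by positivity
                                      linarith
    have hG := Real.Gamma_pos_of_pos hk
    push_cast [Nat.factorial_succ, pow_succ]
    rw [show (k:ℝ) + 1 + α + 1 = (k + α + 1) + 1 by ring, Real.Gamma_add_one hk.ne']
    have := hG.ne'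
    have := hk.ne'
    field_simp
    ring
  · subst h; simp
  · rw [if_neg (by omega), if_neg (by omega)]; simp

noncomputable def lagP (α : ℝ) (n : ℕ) : Polynomial ℝ :=
  ∑ k ∈ Finset.range (n + 1), Polynomial.monomial k (lagC α n k)

lemma lagP_coeff (α : ℝ) (n k : ℕ) : (lagP α n).coeff k = lagC α n k := by
  unfold lagP
  simp only [Polynomial.finsetSum_coeff, Polynomial.coeff_monomial]
  rw [Finset.sum_ite_eq' (Finset.range (n+1)) k]
  split_ifs with h
  · rfl
  · unfold lagC
    rw [if_neg]; simpa using h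

lemma lagP_eval (α : ℝ) (n : ℕ) (x : ℝ) : (lagP α n).eval x = genLaguerre α n x := by
  unfold lagP genLaguerre
  rw [Polynomial.eval_finsetSum]
  refine Finset.sum_congr rfl fun k hk => ?_
  rw [Polynomial.eval_monomial, lagC, if_pos (by simpa [Nat.lt_succ_iff] using hk)]

lemma lagP_ode (α : ℝ) (hα : -1 < α) (n : ℕ) (x : ℝ) :
    x * (lagP α n).derivative.derivative.eval x + (α + 1 - x) * (lagP α n).derivative.eval x
      + n * (lagP α n).eval x = 0 := by
  have : Polynomial.X * (lagP α n).derivative.derivative + Polynomial.C (α + 1) * (lagP α n).derivative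
      - Polynomial.X * (lagP α n).derivative + Polynomial.C (n:ℝ) * lagP α n = 0 := by
    ext k
    cases k with
    | zero =>
      have := lagC_rec α hα n 0
      simp [Polynomial.coeff_derivative, lagP_coeff] at this ⊢
      linarith
    | succ k =>
      have := lagC_rec α hα n (k+1)
      simp only [Polynomial.coeff_add, Polynomial.coeff_sub, Polynomial.coeff_X_mul,
        Polynomial.coeff_C_mul, Polynomial.coeff_derivative, lagP_coeff, Polynomial.coeff_zero]
      push_cast at this ⊢
      linear_combination this
  have h := congrArg (Polynomial.eval x) this
  simp only [Polynomial.eval_add, Polynomial.eval_sub, Polynomial.eval_mul, Polynomial.eval_X,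
    Polynomial.eval_C, Polynomial.eval_zero] at h
  linear_combination h

lemma lagC_zero_pos (α : ℝ) (hα : -1 < α) (n : ℕ) : 0 < lagC α n 0 := by
  have h1 : 0 < Real.Gamma (n + α + 1) := Real.Gamma_pos_of_pos (by
    have : (0:ℝ) ≤ n := by positivity
    linarith)
  have h2 : 0 < Real.Gamma (α + 1) := Real.Gamma_pos_of_pos (by linarith)
  simp [lagC]
  positivity

lemma lagC_bound (α : ℝ) (hα : -1 < α) (n k : ℕ) (hn : 1 ≤ n) :
    |lagC α n k| ≤ lagC α n 0 * ((1 / (α + 1)) ^ k / k.factorial) * (n:ℝ) ^ k := by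
  have hn' : (1:ℝ) ≤ n := by exact_mod_cast hn
  induction k with
  | zero => simp [abs_of_pos (lagC_zero_pos α hα n)]
  | succ k ih =>
    have h0 := lagC_zero_pos α hα n
    have ha : 0 < α + 1 := by linarith
    have hk0 : (0:ℝ) ≤ k := by positivity
    by_cases hkn : k + 1 ≤ n
    · have hkn' : (k:ℝ) + 1 ≤ n := by exact_mod_cast hkn
      have hrec := congrArg abs (lagC_rec α hα n k)
      rw [abs_mul, abs_mul (-((n:ℝ) - k)), abs_of_pos (mul_pos (by linarith) (by linarith) : 0 < ((k:ℝ) + 1) * (k + α + 1)), abs_neg,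
        abs_of_nonneg (by linarith : 0 ≤ (n:ℝ) - k)] at hrec
      have s1 : ((k:ℝ) + 1) * (α + 1) * |lagC α n (k+1)| ≤ n * |lagC α n k| := by
        calc _ ≤ ((k:ℝ) + 1) * (k + α + 1) * |lagC α n (k+1)| := by
              gcongr; linarith
          _ = _ := hrec
          _ ≤ _ := by gcongr; linarith
      have s2 := s1.trans (mul_le_mul_of_nonneg_left ih (by linarith))
      rw [← le_div_iff₀' (by positivity)] at s2
      refine s2.trans (le_of_eq ?_)
      push_cast [Nat.factorial_succ, pow_succ]
      field_simp
    · rw [show lagC α n (k+1) = 0 by rw [lagC, if_neg hkn]]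
      simp only [abs_zero]
      positivity

lemma lagP_small (α : ℝ) (hα : -1 < α) (n : ℕ) (hn : 1 ≤ n) :
    |(lagP α n).eval (1 / (n:ℝ))| ≤ lagC α n 0 * exp (1 / (α + 1)) := by
  have hn' : (1:ℝ) ≤ n := by exact_mod_cast hn
  have ha : 0 < α + 1 := by linarith
  unfold lagP
  rw [Polynomial.eval_finsetSum]
  refine (Finset.abs_sum_le_sum_abs _ _).trans ?_
  refine le_trans ?_ (mul_le_mul_of_nonneg_left (Real.sum_le_exp_of_nonneg (by positivity : 0 ≤ 1 / (α+1)) (n+1)) (lagC_zero_pos α hα n).le)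
  rw [Finset.mul_sum]
  refine Finset.sum_le_sum fun k _ => ?_
  rw [Polynomial.eval_monomial, abs_mul, abs_of_nonneg (by positivity : (0:ℝ) ≤ (1 / (n:ℝ))^k)]
  refine (mul_le_mul_of_nonneg_right (lagC_bound α hα n k hn) (by positivity)).trans (le_of_eq ?_)
  rw [one_div_pow (n:ℝ)]
  field_simp

lemma lagP_deriv_small (α : ℝ) (hα : -1 < α) (n : ℕ) (hn : 1 ≤ n) :
    |(lagP α n).derivative.eval (1 / (n:ℝ))| ≤ n * (lagC α n 0 * exp (2 * (1 / (α + 1)))) := by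
  have hn' : (1:ℝ) ≤ n := by exact_mod_cast hn
  have ha : 0 < α + 1 := by linarith
  have h0 := lagC_zero_pos α hα n
  unfold lagP
  rw [Polynomial.derivative_sum, Polynomial.eval_finsetSum]
  refine (Finset.abs_sum_le_sum_abs _ _).trans ?_
  refine le_trans ?_ (mul_le_mul_of_nonneg_left (mul_le_mul_of_nonneg_left (Real.sum_le_exp_of_nonneg (by positivity : 0 ≤ 2 * (1 / (α+1))) (n+1)) h0.le) (by linarith))
  rw [Finset.mul_sum, Finset.mul_sum]
  refine Finset.sum_le_sum fun k _ => ?_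
  rw [Polynomial.derivative_monomial, Polynomial.eval_monomial, abs_mul, abs_mul, abs_of_nonneg (by positivity : (0:ℝ) ≤ (1 / (n:ℝ))^(k-1)), abs_of_nonneg (by positivity : (0:ℝ) ≤ (k:ℝ))]
  rcases Nat.eq_zero_or_pos k with rfl | hk
  · simp; positivity
  · have hk2 : (k:ℝ) ≤ 2 ^ k := by exact_mod_cast Nat.lt_two_pow_self.le
    calc _ ≤ (lagC α n 0 * ((1 / (α + 1)) ^ k / k.factorial) * (n:ℝ) ^ k) * 2 ^ k * (1 / (n:ℝ))^(k-1) := by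
          gcongr
          exact lagC_bound α hα n k hn
      _ = _ := by
          obtain ⟨j, rfl⟩ : ∃ j, k = j + 1 := ⟨k - 1, by omega⟩
          rw [Nat.add_sub_cancel, mul_pow, one_div_pow (n:ℝ), pow_succ (n:ℝ)]
          field_simp

lemma laguerre_sq_bound (α y : ℝ) (hα : -1 < α) (hy : 0 < y) : ∃ C : ℝ, 0 < C ∧
    ∀ n : ℕ, 1 ≤ n → 1 / y ≤ n →
      (genLaguerre α n y)^2 ≤ C * (n:ℝ) ^ (-(α + 1/2)) * (lagC α n 0)^2 := by
  set K1 := exp (1 / (α + 1)) with hK1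
  set K2 := exp (2 * (1 / (α + 1))) with hK2
  set X := exp ((|2 * α + 2| + (√y)^2) * √y + |α^2 - 1/4|) with hX
  set W := (√y) ^ (α + 1/2) * exp (-(√y)^2/2) with hW
  have hsy : 0 < √y := Real.sqrt_pos.2 hy
  have hW0 : 0 < W := by positivity
  refine ⟨(((|α + 1/2| + 1) * K1 + 2 * K2)^2 + 4 * K1^2) * X / (4 * W^2), by positivity, ?_⟩
  intro n hn hny
  have hn' : (1:ℝ) ≤ n := by exact_mod_cast hn
  set m : ℝ := √(n:ℝ) with hm
  have hm1 : 1 ≤ m := Real.one_le_sqrt.2 hn'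
  have hm0 : 0 < m := by linarith
  have hmm : m ^ 2 = n := Real.sq_sqrt (by linarith)
  have hc := lagC_zero_pos α hα n
  set c := lagC α n 0 with hcdef
  have hab : 1 / m ≤ √y := by
    rw [div_le_iff₀ hm0, hm, ← Real.sqrt_mul hy.le]
    rw [div_le_iff₀ hy] at hny
    exact Real.one_le_sqrt.2 (by linarith)
  have hen := energy_bound α n hn' (fun x => (lagP α n).eval x) (fun x => (lagP α n).derivative.eval x)
    (fun x => (lagP α n).derivative.derivative.eval x) (fun x => Polynomial.hasDerivAt _ x)
    (fun x => Polynomial.hasDerivAt _ x) (lagP_ode α hα n) (1/m) (√y) (by positivity) hab _ rfl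
  rw [show (1 / m * √(n:ℝ)) = 1 by rw [← hm]; field_simp, div_one] at hen
  rw [Real.sq_sqrt hy.le] at hen hX
  rw [Real.sq_sqrt hy.le] at hW
  rw [← hX, ← hW, lagP_eval, show (1/m)^2 = 1/(n:ℝ) by rw [one_div_pow, hmm]] at hen
  have hs1 := lagP_small α hα n hn
  have hs2 := lagP_deriv_small α hα n hn
  rw [← hK1, ← hcdef] at hs1
  rw [← hK2, ← hcdef] at hs2
  set p := (lagP α n).eval (1/(n:ℝ))
  set q := (lagP α n).derivative.eval (1/(n:ℝ))
  set w := (1/m) ^ (α + 1/2) * exp (-(1/(n:ℝ))/2) with hw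
  have hw0 : 0 < w := by positivity
  have hw2 : w^2 ≤ (n:ℝ) ^ (-(α + 1/2)) := by
    have e1 : exp (-(1/(n:ℝ))/2) ≤ 1 := by
      rw [Real.exp_le_one_iff]
      have : 0 < 1/(n:ℝ) := by positivity
      linarith
    have e2 : w ≤ (1/m) ^ (α + 1/2) := by
      rw [hw]; exact mul_le_of_le_one_right (by positivity) e1
    calc w^2 ≤ ((1/m) ^ (α + 1/2))^2 := pow_le_pow_left₀ hw0.le e2 2
      _ = ((1/m)^2) ^ (α + 1/2) := by
        rw [← Real.rpow_natCast, ← Real.rpow_mul (by positivity), mul_comm, Real.rpow_mul (by positivity), Real.rpow_natCast]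
      _ = _ := by
        rw [one_div_pow, hmm, Real.rpow_neg (by positivity), one_div, Real.inv_rpow (by positivity)]
  have hv : |((α + 1/2) / (1/m) - 1/m) * p + 2 * (1/m) * q| ≤ m * c * ((|α + 1/2| + 1) * K1 + 2 * K2) := by
    have t1 : |(α + 1/2) / (1/m) - 1/m| ≤ m * (|α + 1/2| + 1) := by
      have : 1/m ≤ m := by rw [div_le_iff₀ hm0]; nlinarith
      refine (abs_sub _ _).trans ?_
      rw [abs_of_pos (by positivity : 0 < 1/m), abs_div, abs_of_pos (by positivity : 0 < 1/m), div_div_eq_mul_div, div_one]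
      nlinarith
    calc _ ≤ |((α + 1/2) / (1/m) - 1/m)| * |p| + 2 * (1/m) * |q| := by
          refine (abs_add_le _ _).trans (le_of_eq ?_)
          rw [abs_mul, abs_mul, abs_of_pos (by positivity : 0 < 2 * (1/m))]
      _ ≤ (m * (|α + 1/2| + 1)) * (c * K1) + 2 * (1/m) * (n * (c * K2)) := by gcongr
      _ = _ := by rw [← hmm]; field_simp
  have hv2 := pow_le_pow_left₀ (abs_nonneg _) hv 2
  have hp2 := pow_le_pow_left₀ (abs_nonneg _) hs1 2
  rw [sq_abs] at hv2 hp2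
  have hXp : 0 < X := exp_pos _
  have hfin : 4 * n * (W * genLaguerre α n y)^2 ≤
     n * ((((|α + 1/2| + 1) * K1 + 2 * K2)^2 + 4 * K1^2) * X * (n:ℝ) ^ (-(α + 1/2)) * c^2) := by
    calc _ ≤ _ := le_trans (le_add_of_nonneg_left (sq_nonneg _)) hen
      _ = w^2 * ((((α + 1/2) / (1/m) - 1/m) * p + 2 * (1/m) * q)^2 + 4 * n * p^2) * X := by ring
      _ ≤ (n:ℝ) ^ (-(α + 1/2)) * ((m * c * ((|α + 1/2| + 1) * K1 + 2 * K2))^2 + 4 * n * (c * K1)^2) * X := by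
        gcongr
      _ = _ := by rw [← hmm]; ring
  have hfin2 : 4 * (W * genLaguerre α n y)^2 ≤
     ((((|α + 1/2| + 1) * K1 + 2 * K2)^2 + 4 * K1^2) * X * (n:ℝ) ^ (-(α + 1/2)) * c^2) := by
    refine le_of_mul_le_mul_left ?_ (by linarith : (0:ℝ) < n)
    linarith
  rw [div_mul_eq_mul_div, div_mul_eq_mul_div, le_div_iff₀ (by positivity)]
  linarith

/-- Key decay bound (estimate (17)): `c_n^{α,β,η}(y) = π γ_n^{β,η} φ_n^α(y)²` is
`O(n^{-η-1/2})` as `n → ∞`. -/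
theorem stmt_17 (α β η y : ℝ) (hα : -1 < α) (hβ : 0 < β) (hη : 0 < η) (hy : 0 < y) :
    ∃ M : ℝ, 0 < M ∧ ∃ N : ℕ, ∀ n : ℕ, N ≤ n →
      π * gamCoef β η n * (lagPhi α n y) ^ 2 ≤ M * (n : ℝ) ^ (-(η + 1 / 2)) := by
  obtain ⟨C, hC, hL⟩ := laguerre_sq_bound α y hα hy
  have hGη : 0 < Real.Gamma η := Real.Gamma_pos_of_pos hη
  have hGα : 0 < Real.Gamma (α + 1) := Real.Gamma_pos_of_pos (by linarith)
  refine ⟨π * (Real.Gamma η * 4) * (C * 2 / Real.Gamma (α + 1) ^ 2), by positivity, ?_⟩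
  have hev := (((gamma_bounds (α + 1) (by linarith)).and (gamma_bounds β hβ)).and
    (gamma_bounds (β + η) (by linarith))).and
    ((eventually_ge_atTop 1).and (tendsto_natCast_atTop_atTop.eventually_ge_atTop (1 / y)))
  obtain ⟨N, hN⟩ := eventually_atTop.1 hev
  refine ⟨N, fun n hn => ?_⟩
  obtain ⟨⟨⟨⟨g1, -⟩, ⟨g2, -⟩⟩, ⟨-, g3⟩⟩, hn1, hny⟩ := hN n hn
  have hn' : (0:ℝ) < n := by exact_mod_cast hn1
  have hL' := hL n hn1 hny
  have hF : (0:ℝ) < n.factorial := by positivity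
  have hG : 0 < Real.Gamma (n + α + 1) := Real.Gamma_pos_of_pos (by linarith)
  have hc : lagC α n 0 = Real.Gamma (n + α + 1) / (Real.Gamma (α + 1) * n.factorial) := by
    simp [lagC]
  rw [show α + 1 + (n:ℝ) = n + α + 1 by ring, show α + 1 - 1 = α by ring] at g1
  have hphi : (lagPhi α n y)^2 ≤ C * 2 / Real.Gamma (α + 1) ^ 2 * (n:ℝ) ^ (-(1/2 : ℝ)) := by
    unfold lagPhi
    rw [mul_pow, Real.sq_sqrt (by positivity)]
    calc _ ≤ (n.factorial : ℝ) / Real.Gamma (n + α + 1) * (C * (n:ℝ) ^ (-(α + 1/2)) * (lagC α n 0)^2) := by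
          gcongr
      _ = C * (n:ℝ) ^ (-(α + 1/2)) / (Real.Gamma (α+1)^2 * n.factorial) * Real.Gamma (n + α + 1) := by
          rw [hc]; field_simp
      _ ≤ C * (n:ℝ) ^ (-(α + 1/2)) / (Real.Gamma (α+1)^2 * n.factorial) * (2 * (n.factorial * (n:ℝ)^α)) := by
          gcongr
      _ = C * 2 / Real.Gamma (α + 1) ^ 2 * ((n:ℝ) ^ (-(α + 1/2)) * (n:ℝ)^α) := by field_simp
      _ = _ := by
          rw [← Real.rpow_add hn']; congr 2; ring
  have hgam : gamCoef β η n ≤ Real.Gamma η * 4 * (n:ℝ) ^ (-η) := by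
    unfold gamCoef
    have hG3 : 0 < Real.Gamma (β + η + n) := Real.Gamma_pos_of_pos (by positivity)
    rw [div_le_iff₀ hG3]
    have e : (n:ℝ)^(β - 1) = (n:ℝ)^(-η) * (n:ℝ)^(β + η - 1) := by
      rw [← Real.rpow_add hn']; congr 1; ring
    calc _ ≤ Real.Gamma η * (2 * (n.factorial * (n:ℝ)^(β-1))) := by gcongr
      _ = Real.Gamma η * 2 * (n:ℝ)^(-η) * (n.factorial * (n:ℝ)^(β + η - 1)) := by rw [e]; ring
      _ ≤ Real.Gamma η * 2 * (n:ℝ)^(-η) * (2 * Real.Gamma (β + η + n)) := by gcongr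
      _ = _ := by ring
  calc _ ≤ π * (Real.Gamma η * 4 * (n:ℝ) ^ (-η)) * (C * 2 / Real.Gamma (α + 1) ^ 2 * (n:ℝ) ^ (-(1/2 : ℝ))) := by
        gcongr
    _ = π * (Real.Gamma η * 4) * (C * 2 / Real.Gamma (α + 1) ^ 2) * ((n:ℝ) ^ (-η) * (n:ℝ) ^ (-(1/2 : ℝ))) := by ring
    _ = _ := by
        rw [← Real.rpow_add hn']; congr 2; ring
end

section
/- Boundedness criterion at y = 0: let α > -1 and β, η > 0. Then the sequence n ↦ π γ_n^{β,η} φ_n^α(0)² = π Γ(η) Γ(α+n+1) Γ(β+n) / (Γ(α+1)² · n! · Γ(β+η+n)) is bounded above if and only if η ≥ α. -/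
open MeasureTheory Real

open Filter Topology

/-- Normalized Gamma ratio. -/
noncomputable def gamRatio (s : ℝ) (n : ℕ) : ℝ :=
  Real.Gamma (s + n + 1) / ((n : ℝ) ^ s * (Nat.factorial n))

lemma gamma_prod_aux (s : ℝ) (hs : 0 < s) (n : ℕ) :
    Real.Gamma (s + n) = (∏ j ∈ Finset.range n, (s + j)) * Real.Gamma s := by
  induction n with
  | zero => simp
  | succ k ih =>
    rw [Finset.prod_range_succ, Nat.cast_succ, ← add_assoc,
      Real.Gamma_add_one (by positivity), ih]
    ring

lemma gamRatio_tendsto (s : ℝ) (hs : 0 < s) :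
    Tendsto (gamRatio s) atTop (𝓝 1) := by
  have hG : Real.Gamma s ≠ 0 := (Real.Gamma_pos_of_pos hs).ne'
  have h := (tendsto_const_nhds (x := Real.Gamma s)).div (Real.GammaSeq_tendsto_Gamma s) hG
  rw [div_self hG] at h
  refine h.congr fun n => ?_
  have := gamma_prod_aux s hs (n + 1)
  rw [Nat.cast_succ, ← add_assoc] at this
  simp only [Pi.div_apply, Real.GammaSeq, gamRatio]
  rw [this, div_div_eq_mul_div, mul_comm (Real.Gamma s)]

lemma lag_formula (α β η : ℝ) (hα : -1 < α) (n : ℕ) :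
    π * gamCoef β η n * (lagPhi α n 0) ^ 2 =
      π * Real.Gamma η * Real.Gamma (α + n + 1) * Real.Gamma (β + n) /
        ((Real.Gamma (α + 1)) ^ 2 * (Nat.factorial n) * Real.Gamma (β + η + n)) := by
  have hn : (0 : ℝ) ≤ n := Nat.cast_nonneg n
  have h1 : 0 < Real.Gamma (α + n + 1) := Real.Gamma_pos_of_pos (by linarith)
  have h2 : 0 < Real.Gamma (α + 1) := Real.Gamma_pos_of_pos (by linarith)
  have hf : (0 : ℝ) < Nat.factorial n := by exact_mod_cast Nat.factorial_pos n
  have hL : genLaguerre α n 0 =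
      Real.Gamma (α + n + 1) / (Real.Gamma (α + 1) * Nat.factorial n) := by
    unfold genLaguerre
    rw [Finset.sum_eq_single 0]
    · simp [add_comm α (n : ℝ)]
    · intro k _ hk
      simp [hk]
    · simp
  have hP : (lagPhi α n 0) ^ 2 =
      Real.Gamma (α + n + 1) / (Real.Gamma (α + 1) ^ 2 * Nat.factorial n) := by
    unfold lagPhi
    rw [mul_pow, hL, add_comm (n : ℝ) α, Real.sq_sqrt (by positivity)]
    field_simp
  rw [hP, gamCoef]
  simp only [div_eq_mul_inv, mul_inv]
  ring

lemma lag_asymp (α β η : ℝ) (hα : -1 < α) (n : ℕ) (hn : 0 < n) :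
    (π * Real.Gamma η / Real.Gamma (α + 1) ^ 2) *
      ((gamRatio (α + 1) n * gamRatio β n) / (gamRatio 1 n * gamRatio (β + η) n)) *
      (n : ℝ) ^ (α - η) = π * gamCoef β η (n + 1) * (lagPhi α (n + 1) 0) ^ 2 := by
  rw [lag_formula α β η hα]
  have hn' : (0 : ℝ) < n := by exact_mod_cast hn
  have hf : (0 : ℝ) < Nat.factorial n := by exact_mod_cast Nat.factorial_pos n
  have e1 : Real.Gamma (1 + n + 1) = Nat.factorial (n + 1) := by
    have := Real.Gamma_nat_eq_factorial (n + 1)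
    rw [← this]; push_cast; ring_nf
  have e2 : (n : ℝ) ^ (α + 1) * (n : ℝ) ^ β * (n : ℝ) ^ (η - α) =
      (n : ℝ) ^ (1 : ℝ) * (n : ℝ) ^ (β + η) := by
    rw [← Real.rpow_add hn', ← Real.rpow_add hn', ← Real.rpow_add hn']
    congr 1; ring
  have e3 : (n : ℝ) ^ (α - η) = ((n : ℝ) ^ (η - α))⁻¹ := by
    rw [← Real.rpow_neg hn'.le]; congr 1; ring
  have p1 := Real.rpow_pos_of_pos hn' (α + 1)
  have p2 := Real.rpow_pos_of_pos hn' β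
  have p3 := Real.rpow_pos_of_pos hn' (η - α)
  have p4 := Real.rpow_pos_of_pos hn' (1 : ℝ)
  have p5 := Real.rpow_pos_of_pos hn' (β + η)
  unfold gamRatio
  rw [e1, e3]
  have c1 : α + ((n + 1 : ℕ) : ℝ) + 1 = α + 1 + n + 1 := by push_cast; ring
  have c2 : β + ((n + 1 : ℕ) : ℝ) = β + n + 1 := by push_cast; ring
  have c3 : β + η + ((n + 1 : ℕ) : ℝ) = β + η + n + 1 := by push_cast; ring
  rw [c1, c2, c3]
  generalize (n : ℝ) ^ (α + 1) = a at *
  generalize (n : ℝ) ^ β = b at *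
  generalize (n : ℝ) ^ (η - α) = c at *
  generalize (n : ℝ) ^ (1 : ℝ) = d at *
  generalize (n : ℝ) ^ (β + η) = e at *
  have key : d * e / (a * b * c) = 1 := by rw [← e2]; field_simp
  generalize Real.Gamma (α + 1 + n + 1) = A
  generalize Real.Gamma (β + n + 1) = B
  generalize Real.Gamma (β + η + n + 1) = D
  generalize Real.Gamma (α + 1) = G
  generalize ((Nat.factorial (n + 1) : ℕ) : ℝ) = F
  generalize ((Nat.factorial n : ℕ) : ℝ) = f at *
  have : π * Real.Gamma η / G ^ 2 * (A / (a * f) * (B / (b * f)) / (F / (d * f) * (D / (e * f)))) * c⁻¹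
     = (π * Real.Gamma η * A * B / (G ^ 2 * F * D)) * (d * e / (a * b * c)) * ((f / f) * (f / f)) := by
    simp only [div_eq_mul_inv, mul_inv, inv_inv]
    ring
  rw [this, key, div_self hf.ne']
  ring

/-- Boundedness criterion at `y = 0`: the sequence
`n ↦ π γ_n^{β,η} φ_n^α(0)² = π Γ(η) Γ(α+n+1) Γ(β+n) / (Γ(α+1)² n! Γ(β+η+n))`
is bounded above if and only if `η ≥ α`. -/
theorem stmt_19 (α β η : ℝ) (hα : -1 < α) (hβ : 0 < β) (hη : 0 < η) :
    (∀ n : ℕ, π * gamCoef β η n * (lagPhi α n 0) ^ 2 =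
      π * Real.Gamma η * Real.Gamma (α + n + 1) * Real.Gamma (β + n) /
        ((Real.Gamma (α + 1)) ^ 2 * (Nat.factorial n) * Real.Gamma (β + η + n))) ∧
    ((∃ C : ℝ, ∀ n : ℕ, π * gamCoef β η n * (lagPhi α n 0) ^ 2 ≤ C) ↔ α ≤ η) := by
  refine ⟨lag_formula α β η hα, ?_⟩
  set c : ℝ := π * Real.Gamma η / Real.Gamma (α + 1) ^ 2 with hc
  have hcpos : 0 < c := by
    have h1 := Real.Gamma_pos_of_pos hη
    have h2 : 0 < Real.Gamma (α + 1) := Real.Gamma_pos_of_pos (by linarith)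
    have := Real.pi_pos
    positivity
  have hr : Tendsto (fun n : ℕ => c * ((gamRatio (α + 1) n * gamRatio β n) /
      (gamRatio 1 n * gamRatio (β + η) n))) atTop (𝓝 c) := by
    have h := (((gamRatio_tendsto (α + 1) (by linarith)).mul (gamRatio_tendsto β hβ)).div
      ((gamRatio_tendsto 1 one_pos).mul (gamRatio_tendsto (β + η) (by linarith)))
      (by norm_num)).const_mul c
    simpa using h
  have hev : (fun n : ℕ => c * ((gamRatio (α + 1) n * gamRatio β n) /
      (gamRatio 1 n * gamRatio (β + η) n)) * (n : ℝ) ^ (α - η)) =ᶠ[atTop]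
      fun n : ℕ => π * gamCoef β η (n + 1) * (lagPhi α (n + 1) 0) ^ 2 := by
    filter_upwards [eventually_gt_atTop 0] with n hn
    exact lag_asymp α β η hα n hn
  constructor
  · rintro ⟨C, hC⟩
    by_contra! hlt
    have hp : Tendsto (fun n : ℕ => (n : ℝ) ^ (α - η)) atTop atTop :=
      (tendsto_rpow_atTop (sub_pos.2 hlt)).comp tendsto_natCast_atTop_atTop
    have ht := (hr.pos_mul_atTop hcpos hp).congr' hev
    obtain ⟨n, hn⟩ := (ht.eventually_gt_atTop C).exists
    exact absurd (hC (n + 1)) (not_le.2 hn)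
  · intro hle
    obtain ⟨l, hl⟩ : ∃ l, Tendsto (fun n : ℕ => (n : ℝ) ^ (α - η)) atTop (𝓝 l) := by
      rcases hle.eq_or_lt with h | h
      · exact ⟨1, by simp [h]⟩
      · refine ⟨0, ?_⟩
        have := (tendsto_rpow_neg_atTop (sub_pos.2 h)).comp (tendsto_natCast_atTop_atTop (R := ℝ))
        simpa [Function.comp_def] using this
    have ht := (hr.mul hl).congr' hev
    have ht' := (tendsto_add_atTop_iff_nat
      (f := fun n : ℕ => π * gamCoef β η n * (lagPhi α n 0) ^ 2) 1).1 ht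
    obtain ⟨C, hC⟩ := ht'.bddAbove_range
    exact ⟨C, fun n => hC ⟨n, rfl⟩⟩
end
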